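/- arXiv:2406.07984 — 3 statements merged into one kernel-verified Lean document; each statement's English description precedes it below -/
import Mathlib

section
/- Let f : ℝ² → ℝ and F : ℝ² → ℝ² be smooth functions satisfying Δf = curl F := ∂₁F₂ − ∂₂F₁. Then there exists an absolute constant C > 0 such that for all x ∈ ℝ² and r > 0, |f(x)| ≤ C r⁻¹ ‖f‖_{L²(B(x,r))} + C ∫_{B(x,r)} |F(y)|/|y−x| dy. -/
open MeasureTheory
open scoped ContDiff

local notation "E2" => EuclideanSpace ℝ (Fin 2)

/-- A smooth cutoff on the line, together with its first two derivatives. -/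
theorem exists_cutoff :
    ∃ (χ χ₁ χ₂ : ℝ → ℝ) (M : ℝ), (∀ s, HasDerivAt χ (χ₁ s) s) ∧ (∀ s, HasDerivAt χ₁ (χ₂ s) s) ∧
      Continuous χ₂ ∧ 0 ≤ M ∧ (∀ s, |χ s| ≤ 1) ∧ (∀ s, |χ₁ s| ≤ M) ∧ (∀ s, |χ₂ s| ≤ M) ∧
      χ 0 = 1 ∧ (∀ s < 1 / 4, χ₁ s = 0 ∧ χ₂ s = 0) ∧
      (∀ s > 1 / 2, χ s = 0 ∧ χ₁ s = 0 ∧ χ₂ s = 0) := by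
  set χ : ℝ → ℝ := fun s => Real.smoothTransition (2 - 4 * s) with hχ
  have hsm : ContDiff ℝ ∞ χ := Real.smoothTransition.contDiff.comp (by fun_prop)
  have hsm1 : ContDiff ℝ ∞ (deriv χ) := (contDiff_infty_iff_deriv.1 hsm).2
  have hsm2 : ContDiff ℝ ∞ (deriv (deriv χ)) := (contDiff_infty_iff_deriv.1 hsm1).2
  have h0 : ∀ s < 1 / 4, deriv χ s = 0 := by
    intro s hs
    have : χ =ᶠ[nhds s] fun _ => 1 := by
      filter_upwards [Iio_mem_nhds hs] with t ht
      exact Real.smoothTransition.one_of_one_le (by linarith [Set.mem_Iio.1 ht])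
    rw [this.deriv_eq, deriv_const]
  have h0' : ∀ s < 1 / 4, deriv (deriv χ) s = 0 := by
    intro s hs
    have : deriv χ =ᶠ[nhds s] fun _ => 0 := by
      filter_upwards [Iio_mem_nhds hs] with t ht using h0 t ht
    rw [this.deriv_eq, deriv_const]
  have hz : ∀ s > 1 / 2, χ s = 0 := fun s hs =>
    Real.smoothTransition.zero_of_nonpos (by linarith)
  have h1 : ∀ s > 1 / 2, deriv χ s = 0 := by
    intro s hs
    have : χ =ᶠ[nhds s] fun _ => 0 := by
      filter_upwards [Ioi_mem_nhds hs] with t ht using hz t ht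
    rw [this.deriv_eq, deriv_const]
  have h1' : ∀ s > 1 / 2, deriv (deriv χ) s = 0 := by
    intro s hs
    have : deriv χ =ᶠ[nhds s] fun _ => 0 := by
      filter_upwards [Ioi_mem_nhds hs] with t ht using h1 t ht
    rw [this.deriv_eq, deriv_const]
  obtain ⟨A, hA⟩ := (isCompact_Icc (a := (1 / 4 : ℝ)) (b := 1 / 2)).exists_bound_of_continuousOn
    hsm1.continuous.continuousOn
  obtain ⟨B, hB⟩ := (isCompact_Icc (a := (1 / 4 : ℝ)) (b := 1 / 2)).exists_bound_of_continuousOn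
    hsm2.continuous.continuousOn
  have hM : 0 ≤ max 0 (max A B) := le_max_left _ _
  refine ⟨χ, deriv χ, deriv (deriv χ), max 0 (max A B),
    fun s => (hsm.differentiable (by simp) s).hasDerivAt,
    fun s => (hsm1.differentiable (by simp) s).hasDerivAt, hsm2.continuous, hM, ?_, ?_, ?_, ?_,
    fun s hs => ⟨h0 s hs, h0' s hs⟩, fun s hs => ⟨hz s hs, h1 s hs, h1' s hs⟩⟩
  · intro s
    rw [abs_of_nonneg (Real.smoothTransition.nonneg _)]
    exact Real.smoothTransition.le_one _
  · intro s
    by_cases h : s < 1 / 4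
    · rw [h0 s h, abs_zero]; exact hM
    by_cases h' : 1 / 2 < s
    · rw [h1 s h', abs_zero]; exact hM
    exact (hA s ⟨not_lt.1 h, not_lt.1 h'⟩).trans ((le_max_left _ _).trans (le_max_right _ _))
  · intro s
    by_cases h : s < 1 / 4
    · rw [h0' s h, abs_zero]; exact hM
    by_cases h' : 1 / 2 < s
    · rw [h1' s h', abs_zero]; exact hM
    exact (hB s ⟨not_lt.1 h, not_lt.1 h'⟩).trans ((le_max_right _ _).trans (le_max_right _ _))
  · exact Real.smoothTransition.one_of_one_le (by norm_num)

theorem integral_mul_lineDeriv_eq_neg {u u' g g' : E2 → ℝ} {v : E2}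
    (hu : Continuous u) (hu' : Continuous u') (hg : Continuous g) (hg' : Continuous g')
    (hc : HasCompactSupport u) (hc' : HasCompactSupport u')
    (hdu : ∀ y, HasLineDerivAt ℝ u (u' y) y v) (hdg : ∀ y, HasLineDerivAt ℝ g (g' y) y v) :
    ∫ y, u y * g' y = -∫ y, u' y * g y :=
  integral_bilinear_hasLineDerivAt_right_eq_neg_left_of_integrable
    (B := ContinuousLinearMap.mul ℝ ℝ)
    ((hu'.mul hg).integrable_of_hasCompactSupport hc'.mul_right)
    ((hu.mul hg').integrable_of_hasCompactSupport hc.mul_right)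
    ((hu.mul hg).integrable_of_hasCompactSupport hc.mul_right)
    (fun y _ => hdu y) (fun y _ => hdg y)

theorem hasLineDerivAt_radial {h : ℝ → ℝ} {h' : ℝ} {y : E2} (hh : HasDerivAt h h' (‖y‖ ^ 2))
    (i : Fin 2) :
    HasLineDerivAt ℝ (fun z : E2 => h (‖z‖ ^ 2)) (2 * y i * h') y (EuclideanSpace.single i 1) := by
  have h1 : HasFDerivAt (fun z : E2 => ‖z‖ ^ 2) (2 • innerSL ℝ y) y :=
    (hasStrictFDerivAt_norm_sq y).hasFDerivAt
  have h2 := (hh.comp_hasFDerivAt y h1).hasLineDerivAt (EuclideanSpace.single i 1)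
  have h3 : (h' • 2 • innerSL ℝ y) (EuclideanSpace.single i 1) = 2 * y i * h' := by
    have h4 : inner ℝ y (EuclideanSpace.single i (1 : ℝ)) = y i := by
      rw [EuclideanSpace.inner_single_right]
      simp
    simp only [_root_.smul_apply, innerSL_apply_apply, h4, smul_eq_mul, nsmul_eq_mul]
    push_cast
    ring
  rwa [h3] at h2

theorem hasCompactSupport_radial_mul {h : ℝ → ℝ} (hh : ∀ s > 1 / 2, h s = 0) (p : E2 → ℝ) :
    HasCompactSupport fun y : E2 => p y * h (‖y‖ ^ 2) := by
  refine HasCompactSupport.intro (isCompact_closedBall (0 : E2) 1) fun y hy => ?_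
  have : 1 < ‖y‖ := by simpa using hy
  rw [hh _ (by nlinarith), mul_zero]

/-- Testing `Δf = curl F` against a compactly supported radial function. -/
theorem integral_radial_laplacian_mul {h h₁ h₂ : ℝ → ℝ}
    (hd : ∀ s, 0 ≤ s → HasDerivAt h (h₁ s) s) (hd₁ : ∀ s, 0 ≤ s → HasDerivAt h₁ (h₂ s) s)
    (hc₂ : ContinuousOn h₂ (Set.Ici 0))
    (hs : ∀ s > 1 / 2, h s = 0 ∧ h₁ s = 0 ∧ h₂ s = 0)
    {f : E2 → ℝ} {F : E2 → E2} (hf : ContDiff ℝ ∞ f) (hF : ContDiff ℝ ∞ F)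
    (heq : ∀ x, fderiv ℝ (fun y => fderiv ℝ f y (EuclideanSpace.single 0 1)) x
              (EuclideanSpace.single 0 1)
           + fderiv ℝ (fun y => fderiv ℝ f y (EuclideanSpace.single 1 1)) x
              (EuclideanSpace.single 1 1)
          = fderiv ℝ (fun y => F y 1) x (EuclideanSpace.single 0 1)
            - fderiv ℝ (fun y => F y 0) x (EuclideanSpace.single 1 1)) :
    ∫ y : E2, (4 * h₁ (‖y‖ ^ 2) + 4 * ‖y‖ ^ 2 * h₂ (‖y‖ ^ 2)) * f y
      = -∫ y : E2, 2 * h₁ (‖y‖ ^ 2) * (y 0 * F y 1 - y 1 * F y 0) := by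
  have ck : ∀ k : ℝ → ℝ, ContinuousOn k (Set.Ici 0) → Continuous fun y : E2 => k (‖y‖ ^ 2) :=
    fun k hk => hk.comp_continuous (by fun_prop) (fun y => Set.mem_Ici.2 (by positivity))
  have c0 := ck h fun s hs => (hd s hs).continuousAt.continuousWithinAt
  have c1 := ck h₁ fun s hs => (hd₁ s hs).continuousAt.continuousWithinAt
  have c2 := ck h₂ hc₂
  have e1 : ∀ i : Fin 2, Continuous fun y : E2 => 2 * y i * h₁ (‖y‖ ^ 2) := fun i =>
    Continuous.mul (by fun_prop) c1
  have e2 : ∀ i : Fin 2, Continuous fun y : E2 =>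
      2 * h₁ (‖y‖ ^ 2) + 4 * y i ^ 2 * h₂ (‖y‖ ^ 2) := fun i =>
    (continuous_const.mul c1).add (Continuous.mul (by fun_prop) c2)
  have s0 : HasCompactSupport fun y : E2 => h (‖y‖ ^ 2) := by
    simpa using hasCompactSupport_radial_mul (fun s h => (hs s h).1) (fun _ => 1)
  have s1 := hasCompactSupport_radial_mul (fun s h => (hs s h).2.1)
  have s2 := hasCompactSupport_radial_mul (fun s h => (hs s h).2.2)
  have d0 : ∀ (i : Fin 2) (y : E2), HasLineDerivAt ℝ (fun z : E2 => h (‖z‖ ^ 2))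
      (2 * y i * h₁ (‖y‖ ^ 2)) y (EuclideanSpace.single i 1) :=
    fun i y => hasLineDerivAt_radial (hd _ (by positivity)) i
  have d1 : ∀ (i : Fin 2) (y : E2), HasLineDerivAt ℝ (fun z : E2 => 2 * z i * h₁ (‖z‖ ^ 2))
      (2 * h₁ (‖y‖ ^ 2) + 4 * y i ^ 2 * h₂ (‖y‖ ^ 2)) y (EuclideanSpace.single i 1) := by
    intro i y
    have a : HasDerivAt (fun t : ℝ => 2 * (y + t • EuclideanSpace.single i (1 : ℝ) : E2) i) 2 0 := by
      simpa using ((hasDerivAt_id (0 : ℝ)).const_add (y i)).const_mul 2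
    have b : HasDerivAt _ _ _ := hasLineDerivAt_radial (hd₁ (‖y‖ ^ 2) (by positivity)) i
    have := a.mul b
    simp only [zero_smul, add_zero] at this
    have e : 2 * h₁ (‖y‖ ^ 2) + 2 * y i * (2 * y i * h₂ (‖y‖ ^ 2))
        = 2 * h₁ (‖y‖ ^ 2) + 4 * y i ^ 2 * h₂ (‖y‖ ^ 2) := by ring
    rwa [e] at this
  have cs2 : ∀ i : Fin 2,
      HasCompactSupport fun y : E2 => 2 * h₁ (‖y‖ ^ 2) + 4 * y i ^ 2 * h₂ (‖y‖ ^ 2) :=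
    fun i => (s1 (fun _ => 2)).add (s2 (fun y => 4 * y i ^ 2))
  have df : ∀ {g : E2 → ℝ} (_ : ContDiff ℝ ∞ g) (v y : E2),
      HasLineDerivAt ℝ g (fderiv ℝ g y v) y v := fun hg v y =>
    (hg.differentiable (by simp) y).hasFDerivAt.hasLineDerivAt v
  have sm : ∀ {g : E2 → ℝ} (_ : ContDiff ℝ ∞ g) (v : E2),
      ContDiff ℝ ∞ fun y => fderiv ℝ g y v := fun hg v =>
    (hg.fderiv_right (m := ∞) (by simp)).clm_apply contDiff_const
  have L : ∀ i : Fin 2, ∫ y : E2, h (‖y‖ ^ 2) *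
        fderiv ℝ (fun y => fderiv ℝ f y (EuclideanSpace.single i 1)) y (EuclideanSpace.single i 1)
      = ∫ y : E2, (2 * h₁ (‖y‖ ^ 2) + 4 * y i ^ 2 * h₂ (‖y‖ ^ 2)) * f y := by
    intro i
    rw [integral_mul_lineDeriv_eq_neg c0 (e1 i) (sm hf _).continuous
      (sm (sm hf _) _).continuous s0 (s1 fun y => 2 * y i) (d0 i) (df (sm hf _) _),
      integral_mul_lineDeriv_eq_neg (e1 i) (e2 i) hf.continuous
      (sm hf _).continuous (s1 fun y => 2 * y i) (cs2 i) (d1 i) (df hf _), neg_neg]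
  have sF : ∀ j : Fin 2, ContDiff ℝ ∞ fun y => F y j := fun j => by fun_prop
  have K : ∀ i j : Fin 2, ∫ y : E2, h (‖y‖ ^ 2) *
        fderiv ℝ (fun y => F y j) y (EuclideanSpace.single i 1)
      = -∫ y : E2, (2 * y i * h₁ (‖y‖ ^ 2)) * F y j := fun i j =>
    integral_mul_lineDeriv_eq_neg c0 (e1 i) (sF j).continuous
      (sm (sF j) _).continuous s0 (s1 fun y => 2 * y i) (d0 i) (df (sF j) _)
  have iL : ∀ i : Fin 2, Integrable fun y : E2 => h (‖y‖ ^ 2) *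
        fderiv ℝ (fun y => fderiv ℝ f y (EuclideanSpace.single i 1)) y
          (EuclideanSpace.single i 1) := fun i =>
    (c0.mul (sm (sm hf _) _).continuous).integrable_of_hasCompactSupport s0.mul_right
  have iK : ∀ i j : Fin 2, Integrable fun y : E2 => h (‖y‖ ^ 2) *
        fderiv ℝ (fun y => F y j) y (EuclideanSpace.single i 1) := fun i j =>
    (c0.mul (sm (sF j) _).continuous).integrable_of_hasCompactSupport s0.mul_right
  have iL' : ∀ i : Fin 2, Integrable fun y : E2 =>
      (2 * h₁ (‖y‖ ^ 2) + 4 * y i ^ 2 * h₂ (‖y‖ ^ 2)) * f y := fun i =>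
    ((e2 i).mul hf.continuous).integrable_of_hasCompactSupport (cs2 i).mul_right
  have iK' : ∀ i j : Fin 2, Integrable fun y : E2 => (2 * y i * h₁ (‖y‖ ^ 2)) * F y j :=
    fun i j => ((e1 i).mul (sF j).continuous).integrable_of_hasCompactSupport
      (s1 fun y => 2 * y i).mul_right
  calc _ = ∫ y : E2, ((2 * h₁ (‖y‖ ^ 2) + 4 * y 0 ^ 2 * h₂ (‖y‖ ^ 2)) * f y
          + (2 * h₁ (‖y‖ ^ 2) + 4 * y 1 ^ 2 * h₂ (‖y‖ ^ 2)) * f y) := by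
        congr 1 with y
        have : ‖y‖ ^ 2 = y 0 ^ 2 + y 1 ^ 2 := by simp [EuclideanSpace.norm_sq_eq]
        rw [mul_assoc 4 (‖y‖ ^ 2)]
        nth_rewrite 2 [this]
        ring
    _ = ∫ y : E2, (h (‖y‖ ^ 2) * fderiv ℝ (fun y => F y 1) y (EuclideanSpace.single 0 1)
          - h (‖y‖ ^ 2) * fderiv ℝ (fun y => F y 0) y (EuclideanSpace.single 1 1)) := by
        rw [integral_add (iL' 0) (iL' 1), ← L 0, ← L 1, ← integral_add (iL 0) (iL 1)]
        congr 1 with y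
        rw [← mul_add, heq, mul_sub]
    _ = _ := by
        rw [integral_sub (iK 0 1) (iK 1 0), K, K, ← neg_sub_neg, neg_neg, neg_neg,
          ← integral_sub (iK' 1 0) (iK' 0 1), ← integral_neg]
        congr 1 with y
        ring

theorem abs_log_le_three {t : ℝ} (h : 1 / 4 ≤ t) (h' : t ≤ 2) : |Real.log t| ≤ 3 := by
  have ht : 0 < t := by linarith
  have h1 := Real.log_le_sub_one_of_pos ht
  have h2 := Real.one_sub_inv_le_log_of_pos ht
  have h3 : t⁻¹ ≤ 4 := by rw [inv_le_comm₀ ht (by norm_num)]; linarith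
  exact abs_le.2 ⟨by linarith, by linarith⟩

theorem abs_integral_le_setIntegral_ball {g k : E2 → ℝ} {r : ℝ}
    (hz : ∀ y ∉ Metric.ball (0 : E2) r, g y = 0) (hk : IntegrableOn k (Metric.ball 0 r))
    (hgk : ∀ y ∈ Metric.ball (0 : E2) r, |g y| ≤ k y) :
    |∫ y, g y| ≤ ∫ y in Metric.ball 0 r, k y := by
  rw [← setIntegral_eq_integral_of_forall_compl_eq_zero hz, ← Real.norm_eq_abs]
  exact norm_integral_le_of_norm_le hk
    ((ae_restrict_iff' measurableSet_ball).2 (Filter.Eventually.of_forall hgk))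

theorem integrableOn_ball_norm_div_norm {F : E2 → E2} (hF : Continuous F) (r : ℝ) :
    IntegrableOn (fun y => ‖F y‖ / ‖y‖) (Metric.ball 0 r) := by
  obtain ⟨C, hC⟩ := (isCompact_closedBall (0 : E2) r).exists_bound_of_continuousOn
    hF.continuousOn
  refine integrableOn_ball_of_norm_le_rpow (C := C) (α := 1) (by simp) (by simp)
    ((ae_restrict_iff' measurableSet_ball).2 (Filter.Eventually.of_forall fun y hy => ?_))
    (hF.norm.measurable.div measurable_norm).aestronglyMeasurable
  rw [Real.rpow_neg_one, norm_div, norm_norm, norm_norm, div_eq_mul_inv]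
  exact mul_le_mul_of_nonneg_right (hC y (Metric.ball_subset_closedBall hy)) (by positivity)

/-- The truncated, regularized fundamental solution bounds the mollification of `f` uniformly. -/
theorem exists_abs_integral_mollifier_mul_le :
    ∃ (χ : ℝ → ℝ) (C : ℝ), Continuous χ ∧ χ 0 = 1 ∧ (∀ s > 1 / 2, χ s = 0) ∧ 0 ≤ C ∧
      ∀ (f : E2 → ℝ) (F : E2 → E2), ContDiff ℝ ∞ f → ContDiff ℝ ∞ F →
      (∀ x, fderiv ℝ (fun y => fderiv ℝ f y (EuclideanSpace.single 0 1)) x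
              (EuclideanSpace.single 0 1)
           + fderiv ℝ (fun y => fderiv ℝ f y (EuclideanSpace.single 1 1)) x
              (EuclideanSpace.single 1 1)
          = fderiv ℝ (fun y => F y 1) x (EuclideanSpace.single 0 1)
            - fderiv ℝ (fun y => F y 0) x (EuclideanSpace.single 1 1)) →
      ∀ e : ℝ, 0 < e → e ≤ 1 →
        |∫ y : E2, e / (‖y‖ ^ 2 + e) ^ 2 * (χ (‖y‖ ^ 2) * f y)| ≤
          C * (∫ y in Metric.ball 0 1, |f y|) + C * ∫ y in Metric.ball 0 1, ‖F y‖ / ‖y‖ := by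
  obtain ⟨χ, χ₁, χ₂, M, hd, hd₁, hc₂, hM, hb, hb₁, hb₂, hone, hlow, hhigh⟩ := exists_cutoff
  have hc : Continuous χ := continuous_iff_continuousAt.2 fun s => (hd s).continuousAt
  have hc₁ : Continuous χ₁ := continuous_iff_continuousAt.2 fun s => (hd₁ s).continuousAt
  refine ⟨χ, 8 * M + 2, hc, hone, fun s hs => (hhigh s hs).1, by linarith, ?_⟩
  intro f F hf hF heq e he he1
  set R : ℝ → ℝ := fun s =>
    χ₁ s * Real.log (s + e) + s * χ₂ s * Real.log (s + e) + 2 * s * χ₁ s / (s + e) with hR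
  set h₁ : ℝ → ℝ := fun s => χ₁ s * Real.log (s + e) + χ s / (s + e) with hh₁
  set h₂ : ℝ → ℝ := fun s => χ₂ s * Real.log (s + e) + 2 * χ₁ s / (s + e) - χ s / (s + e) ^ 2
    with hh₂
  have hlog : ∀ s, 0 ≤ s → HasDerivAt (fun s => Real.log (s + e)) (1 / (s + e)) s := fun s hs =>
    ((hasDerivAt_id s).add_const e).log (by simp; positivity)
  have hlogc : ContinuousOn (fun s => Real.log (s + e)) (Set.Ici 0) := fun s hs =>
    (hlog s hs).continuousAt.continuousWithinAt
  have hne : ∀ s ∈ Set.Ici (0 : ℝ), s + e ≠ 0 := fun s hs => by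
    have := Set.mem_Ici.1 hs
    positivity
  have hh : ∀ s, 0 ≤ s → HasDerivAt (fun s => χ s * Real.log (s + e)) (h₁ s) s := fun s hs => by
    refine ((hd s).mul (hlog s hs)).congr_deriv ?_
    simp only [hh₁]; ring
  have hh' : ∀ s, 0 ≤ s → HasDerivAt h₁ (h₂ s) s := fun s hs => by
    refine (((hd₁ s).mul (hlog s hs)).add
      ((hd s).div ((hasDerivAt_id s).add_const e) (hne s hs))).congr_deriv ?_
    have := hne s hs
    simp only [hh₂, id]; field_simp; ring
  have hh₂c : ContinuousOn h₂ (Set.Ici 0) :=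
    ((hc₂.continuousOn.mul hlogc).add (ContinuousOn.div (by fun_prop) (by fun_prop) hne)).sub
      (ContinuousOn.div (by fun_prop) (by fun_prop) fun s hs => pow_ne_zero 2 (hne s hs))
  have hRc : ContinuousOn R (Set.Ici 0) :=
    ((hc₁.continuousOn.mul hlogc).add (ContinuousOn.mul (by fun_prop) hlogc)).add
      (ContinuousOn.div (by fun_prop) (by fun_prop) hne)
  have key := integral_radial_laplacian_mul hh hh' hh₂c
    (fun s hs => by simp [hh₁, hh₂, hhigh s hs]) hf hF heq
  have hRz : ∀ s > 1 / 2, R s = 0 := fun s hs => by simp [hR, hhigh s hs]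
  have hχlog : ∀ s, 0 ≤ s → |χ₁ s * Real.log (s + e)| ≤ 3 * M ∧
      |χ₂ s * Real.log (s + e)| ≤ 3 * M := by
    intro s hs
    by_cases h : s < 1 / 4
    · simp [hlow s h, hM]
    by_cases h' : 1 / 2 < s
    · simp [hhigh s h', hM]
    have := abs_log_le_three (t := s + e) (by linarith) (by linarith)
    rw [abs_mul, abs_mul, mul_comm 3 M]
    exact ⟨mul_le_mul (hb₁ s) this (abs_nonneg _) hM, mul_le_mul (hb₂ s) this (abs_nonneg _) hM⟩
  have hquot : ∀ s, 0 ≤ s → s / (s + e) ≤ 1 := fun s hs =>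
    div_le_one_of_le₀ (by linarith) (by linarith)
  have hquot' : ∀ s, 0 ≤ s → 0 ≤ s / (s + e) := fun s hs => by positivity
  have hRb : ∀ s, 0 ≤ s → |R s| ≤ 8 * M := by
    intro s hs
    by_cases h' : 1 / 2 < s
    · rw [hRz s h', abs_zero]; positivity
    have a1 := (hχlog s hs).1
    have a2 : |s * χ₂ s * Real.log (s + e)| ≤ 3 * M := by
      rw [mul_assoc, abs_mul, abs_of_nonneg hs]
      have := (hχlog s hs).2
      nlinarith [abs_nonneg (χ₂ s * Real.log (s + e))]
    have a3 : |2 * s * χ₁ s / (s + e)| ≤ 2 * M := by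
      have : 2 * s * χ₁ s / (s + e) = 2 * (s / (s + e)) * χ₁ s := by ring
      rw [this, abs_mul, abs_of_nonneg (by linarith [hquot' s hs])]
      nlinarith [hb₁ s, abs_nonneg (χ₁ s), hquot s hs, hquot' s hs]
    calc |R s| ≤ _ := abs_add_three _ _ _
      _ ≤ 8 * M := by linarith
  have hh₁b : ∀ s, 0 ≤ s → |s * h₁ s| ≤ 3 * M + 1 := by
    intro s hs
    by_cases h' : 1 / 2 < s
    · simp [hh₁, hhigh s h']; positivity
    have a1 : |s * (χ₁ s * Real.log (s + e))| ≤ 3 * M := by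
      rw [abs_mul, abs_of_nonneg hs]
      have := (hχlog s hs).1
      nlinarith [abs_nonneg (χ₁ s * Real.log (s + e))]
    have a2 : |s / (s + e) * χ s| ≤ 1 := by
      rw [abs_mul, abs_of_nonneg (hquot' s hs)]
      exact mul_le_one₀ (hquot s hs) (abs_nonneg _) (hb s)
    have : s * h₁ s = s * (χ₁ s * Real.log (s + e)) + s / (s + e) * χ s := by
      simp only [hh₁]; ring
    rw [this]
    exact (abs_add_le _ _).trans (by linarith)
  have hout : ∀ y ∉ Metric.ball (0 : E2) 1, ‖y‖ ^ 2 > 1 / 2 := fun y hy => by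
    have : 1 ≤ ‖y‖ := by simpa using hy
    nlinarith
  have ck : ∀ k : ℝ → ℝ, ContinuousOn k (Set.Ici 0) → Continuous fun y : E2 => k (‖y‖ ^ 2) :=
    fun k hk => hk.comp_continuous (by fun_prop) (fun y => Set.mem_Ici.2 (by positivity))
  have iR : Integrable fun y : E2 => 4 * R (‖y‖ ^ 2) * f y :=
    ((continuous_const.mul (ck R hRc)).mul hf.continuous).integrable_of_hasCompactSupport
      (hasCompactSupport_radial_mul hRz fun _ => 4).mul_right
  have iφ : Integrable fun y : E2 => 4 * (e / (‖y‖ ^ 2 + e) ^ 2 * (χ (‖y‖ ^ 2) * f y)) := by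
    have c : Continuous fun y : E2 => 4 * (e / (‖y‖ ^ 2 + e) ^ 2 * (χ (‖y‖ ^ 2) * f y)) := by
      refine continuous_const.mul (Continuous.mul (Continuous.div (by fun_prop) (by fun_prop)
        fun y => by positivity) (Continuous.mul (by fun_prop) hf.continuous))
    refine c.integrable_of_hasCompactSupport ?_
    refine HasCompactSupport.mul_left (f := fun _ => (4 : ℝ)) (HasCompactSupport.mul_left ?_)
    simpa only [mul_comm] using hasCompactSupport_radial_mul (fun s hs => (hhigh s hs).1) f
  have split : 4 * (∫ y : E2, e / (‖y‖ ^ 2 + e) ^ 2 * (χ (‖y‖ ^ 2) * f y))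
      = -(∫ y : E2, 2 * h₁ (‖y‖ ^ 2) * (y 0 * F y 1 - y 1 * F y 0))
        - ∫ y : E2, 4 * R (‖y‖ ^ 2) * f y := by
    rw [← key, eq_sub_iff_add_eq, ← integral_const_mul, ← integral_add iφ iR]
    congr 1 with y
    have := hne (‖y‖ ^ 2) (Set.mem_Ici.2 (by positivity))
    simp only [hh₁, hh₂, hR]
    field_simp
    ring
  have bR : |∫ y : E2, 4 * R (‖y‖ ^ 2) * f y| ≤ ∫ y in Metric.ball 0 1, 4 * (8 * M) * |f y| := by
    refine abs_integral_le_setIntegral_ball (fun y hy => by rw [hRz _ (hout y hy)]; simp)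
      (((hf.continuous.abs.continuousOn.integrableOn_compact
        (isCompact_closedBall 0 1)).mono_set Metric.ball_subset_closedBall).const_mul _) fun y _ => ?_
    rw [abs_mul, abs_mul, abs_of_pos (by norm_num : (0 : ℝ) < 4)]
    gcongr
    exact hRb _ (by positivity)
  have bF : |∫ y : E2, 2 * h₁ (‖y‖ ^ 2) * (y 0 * F y 1 - y 1 * F y 0)|
      ≤ ∫ y in Metric.ball 0 1, 2 * (3 * M + 1) * (‖F y‖ / ‖y‖) := by
    refine abs_integral_le_setIntegral_ball
      (fun y hy => by simp [hh₁, hhigh _ (hout y hy)])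
      ((integrableOn_ball_norm_div_norm hF.continuous 1).const_mul _) fun y _ => ?_
    by_cases hy0 : y = 0
    · simp [hy0]
    have hy : 0 < ‖y‖ := norm_pos_iff.2 hy0
    have cs : |y 0 * F y 1 - y 1 * F y 0| ≤ ‖y‖ * ‖F y‖ := by
      refine abs_le_of_sq_le_sq ?_ (by positivity)
      rw [mul_pow, EuclideanSpace.norm_sq_eq, EuclideanSpace.norm_sq_eq]
      simp only [Fin.sum_univ_two, Real.norm_eq_abs, sq_abs]
      nlinarith [sq_nonneg (y 0 * F y 0 + y 1 * F y 1)]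
    have hb := hh₁b (‖y‖ ^ 2) (by positivity)
    rw [abs_mul, abs_of_nonneg (by positivity : 0 ≤ ‖y‖ ^ 2)] at hb
    rw [abs_mul, abs_mul, abs_of_pos (by norm_num : (0 : ℝ) < 2)]
    calc 2 * |h₁ (‖y‖ ^ 2)| * |y 0 * F y 1 - y 1 * F y 0|
        ≤ 2 * |h₁ (‖y‖ ^ 2)| * (‖y‖ * ‖F y‖) := by gcongr
      _ = 2 * (‖y‖ ^ 2 * |h₁ (‖y‖ ^ 2)|) * (‖F y‖ / ‖y‖) := by field_simp
      _ ≤ 2 * (3 * M + 1) * (‖F y‖ / ‖y‖) := by gcongr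
  rw [integral_const_mul] at bR bF
  have pf : 0 ≤ ∫ y in Metric.ball (0 : E2) 1, |f y| := integral_nonneg fun _ => abs_nonneg _
  have pF : 0 ≤ ∫ y in Metric.ball (0 : E2) 1, ‖F y‖ / ‖y‖ :=
    integral_nonneg fun _ => by positivity
  have tri := abs_sub (-(∫ y : E2, 2 * h₁ (‖y‖ ^ 2) * (y 0 * F y 1 - y 1 * F y 0)))
    (∫ y : E2, 4 * R (‖y‖ ^ 2) * f y)
  rw [← split, abs_mul, abs_of_pos (by norm_num : (0 : ℝ) < 4), abs_neg] at tri
  nlinarith [mul_nonneg hM pf, mul_nonneg hM pF]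

theorem integrable_one_add_norm_sq_sq_inv :
    Integrable fun y : E2 => ((1 + ‖y‖ ^ 2) ^ 2)⁻¹ := by
  refine (integrable_rpow_neg_one_add_norm_sq (E := E2) (μ := volume) (r := 4)
    (by norm_num)).congr (Filter.Eventually.of_forall fun y => ?_)
  simp only
  rw [show (-4 : ℝ) / 2 = -(2 : ℕ) by norm_num, Real.rpow_neg (by positivity),
    Real.rpow_natCast]

theorem integral_one_add_norm_sq_sq_inv_pos :
    0 < ∫ y : E2, ((1 + ‖y‖ ^ 2) ^ 2)⁻¹ := by
  rw [integral_pos_iff_support_of_nonneg (fun y => by positivity)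
    integrable_one_add_norm_sq_sq_inv]
  have : (Function.support fun y : E2 => ((1 + ‖y‖ ^ 2) ^ 2)⁻¹) = Set.univ :=
    Set.eq_univ_of_forall fun y => by
      rw [Function.mem_support]
      positivity
  rw [this]
  exact Measure.measure_univ_pos.2 (NeZero.ne _)

theorem tendsto_integral_mollifier_mul {g : E2 → ℝ} (hg : Integrable g) (hc : Continuous g) :
    Filter.Tendsto (fun c : ℝ => ∫ y : E2, c⁻¹ ^ 2 / (‖y‖ ^ 2 + c⁻¹ ^ 2) ^ 2 * g y) Filter.atTop
      (nhds ((∫ y : E2, ((1 + ‖y‖ ^ 2) ^ 2)⁻¹) * g 0)) := by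
  set I := ∫ y : E2, ((1 + ‖y‖ ^ 2) ^ 2)⁻¹ with hI
  have hIpos : 0 < I := integral_one_add_norm_sq_sq_inv_pos
  have lim : Filter.Tendsto (fun y : E2 => ‖y‖ ^ Module.finrank ℝ E2 *
      (I⁻¹ * ((1 + ‖y‖ ^ 2) ^ 2)⁻¹)) (Bornology.cobounded E2) (nhds 0) := by
    have t : Filter.Tendsto (fun y : E2 => I⁻¹ * (1 + ‖y‖ ^ 2)⁻¹) (Bornology.cobounded E2)
        (nhds 0) := by
      have : Filter.Tendsto (fun y : E2 => 1 + ‖y‖ ^ 2) (Bornology.cobounded E2) Filter.atTop :=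
        Filter.tendsto_atTop_add_const_left _ _
          ((Filter.tendsto_pow_atTop two_ne_zero).comp tendsto_norm_cobounded_atTop)
      simpa using this.inv_tendsto_atTop.const_mul I⁻¹
    refine squeeze_zero (fun y => by positivity) (fun y => ?_) t
    rw [finrank_euclideanSpace_fin, mul_left_comm]
    gcongr
    rw [← div_eq_mul_inv, ← one_div, div_le_div_iff₀ (by positivity) (by positivity)]
    nlinarith [sq_nonneg ‖y‖]
  have main := (tendsto_integral_comp_smul_smul_of_integrable (μ := (volume : Measure E2))
    (φ := fun y => I⁻¹ * ((1 + ‖y‖ ^ 2) ^ 2)⁻¹) (fun y => by positivity)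
    (by rw [integral_const_mul, ← hI, inv_mul_cancel₀ hIpos.ne']) lim hg
    hc.continuousAt).const_mul I
  refine main.congr' ?_
  filter_upwards [Filter.eventually_gt_atTop 0] with c hcpos
  rw [← integral_const_mul]
  congr 1 with y
  rw [finrank_euclideanSpace_fin, norm_smul, Real.norm_of_nonneg hcpos.le, smul_eq_mul]
  field_simp
  ring

theorem setIntegral_abs_le_sqrt {f : E2 → ℝ} (hf : Continuous f) :
    ∫ y in Metric.ball (0 : E2) 1, |f y| ≤
      Real.sqrt (volume.real (Metric.ball (0 : E2) 1)) *
        Real.sqrt (∫ y in Metric.ball (0 : E2) 1, f y ^ 2) := by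
  have hL : ∀ {g : E2 → ℝ}, Continuous g →
      MemLp g (ENNReal.ofReal 2) (volume.restrict (Metric.ball (0 : E2) 1)) := by
    intro g hg
    rw [ENNReal.ofReal_ofNat, memLp_two_iff_integrable_sq hg.aestronglyMeasurable]
    exact ((hg.pow 2).continuousOn.integrableOn_compact
      (isCompact_closedBall 0 1)).mono_set Metric.ball_subset_closedBall
  have := integral_mul_le_Lp_mul_Lq_of_nonneg
    (μ := volume.restrict (Metric.ball (0 : E2) 1)) (f := fun _ => 1) (g := fun y => |f y|)
    Real.HolderConjugate.two_two (Filter.Eventually.of_forall fun _ => zero_le_one)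
    (Filter.Eventually.of_forall fun _ => abs_nonneg _) (hL continuous_const) (hL hf.abs)
  simpa [Real.sqrt_eq_rpow] using this

theorem exists_abs_apply_zero_le :
    ∃ C > 0, ∀ (f : E2 → ℝ) (F : E2 → E2), ContDiff ℝ ∞ f → ContDiff ℝ ∞ F →
      (∀ x, fderiv ℝ (fun y => fderiv ℝ f y (EuclideanSpace.single 0 1)) x
              (EuclideanSpace.single 0 1)
           + fderiv ℝ (fun y => fderiv ℝ f y (EuclideanSpace.single 1 1)) x
              (EuclideanSpace.single 1 1)
          = fderiv ℝ (fun y => F y 1) x (EuclideanSpace.single 0 1)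
            - fderiv ℝ (fun y => F y 0) x (EuclideanSpace.single 1 1)) →
      |f 0| ≤ C * Real.sqrt (∫ y in Metric.ball 0 1, f y ^ 2) +
        C * ∫ y in Metric.ball 0 1, ‖F y‖ / ‖y‖ := by
  obtain ⟨χ, C, hχ, hone, hz, hC, H⟩ := exists_abs_integral_mollifier_mul_le
  set I := ∫ y : E2, ((1 + ‖y‖ ^ 2) ^ 2)⁻¹ with hI
  have hIpos : 0 < I := integral_one_add_norm_sq_sq_inv_pos
  set V := Real.sqrt (volume.real (Metric.ball (0 : E2) 1)) with hV
  have hV0 : 0 ≤ V := Real.sqrt_nonneg _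
  refine ⟨I⁻¹ * C * (V + 1) + 1, by positivity, fun f F hf hF heq => ?_⟩
  have hcont : Continuous fun y : E2 => χ (‖y‖ ^ 2) * f y :=
    Continuous.mul (by fun_prop) hf.continuous
  have hint : Integrable fun y : E2 => χ (‖y‖ ^ 2) * f y := by
    refine hcont.integrable_of_hasCompactSupport ?_
    simpa only [mul_comm] using hasCompactSupport_radial_mul hz f
  have lim := (tendsto_integral_mollifier_mul hint hcont).abs
  have bound := le_of_tendsto lim (Filter.eventually_atTop.2 ⟨1, fun c hc => H f F hf hF heq
    (c⁻¹ ^ 2) (by positivity) (pow_le_one₀ (by positivity) (inv_le_one_of_one_le₀ hc))⟩)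
  rw [← hI, norm_zero, zero_pow two_ne_zero, hone, one_mul, abs_mul, abs_of_pos hIpos] at bound
  have hfV := setIntegral_abs_le_sqrt hf.continuous
  rw [← hV] at hfV
  set S := Real.sqrt (∫ y in Metric.ball (0 : E2) 1, f y ^ 2)
  have hS : 0 ≤ S := Real.sqrt_nonneg _
  set T := ∫ y in Metric.ball (0 : E2) 1, ‖F y‖ / ‖y‖
  have hT : 0 ≤ T := integral_nonneg fun _ => by positivity
  calc |f 0| = I⁻¹ * (I * |f 0|) := by field_simp
    _ ≤ I⁻¹ * (C * (V * S) + C * T) := by gcongr; exact bound.trans (by gcongr)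
    _ = I⁻¹ * C * V * S + I⁻¹ * C * T := by ring
    _ ≤ (I⁻¹ * C * (V + 1) + 1) * S + (I⁻¹ * C * (V + 1) + 1) * T := by
      have : 0 ≤ I⁻¹ * C := by positivity
      gcongr
      · linarith
      · nlinarith [mul_nonneg this hV0]

theorem setIntegral_ball_comp_add_smul (g : E2 → ℝ) (x : E2) {r : ℝ} (hr : 0 < r) :
    ∫ y in Metric.ball (0 : E2) 1, g (x + r • y) = (r ^ 2)⁻¹ * ∫ y in Metric.ball x r, g y := by
  have h1 := Measure.setIntegral_comp_smul_of_pos volume (fun z => g (x + z))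
    (Metric.ball (0 : E2) 1) hr
  rw [finrank_euclideanSpace_fin, smul_unitBall_of_pos hr, smul_eq_mul] at h1
  rw [h1, ← (measurePreserving_add_left volume x).setIntegral_preimage_emb
    (measurableEmbedding_addLeft x) g]
  simp

theorem fderiv_comp_add_smul_apply {g : E2 → ℝ} (hg : Differentiable ℝ g) (x : E2) (r : ℝ)
    (y v : E2) : fderiv ℝ (fun y => g (x + r • y)) y v = r * fderiv ℝ g (x + r • y) v := by
  have h1 : HasFDerivAt (fun y : E2 => x + r • y) (r • ContinuousLinearMap.id ℝ E2) y :=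
    ((hasFDerivAt_id y).const_smul r).const_add x
  have h2 := (hg (x + r • y)).hasFDerivAt.comp y h1
  change fderiv ℝ (g ∘ fun y => x + r • y) y v = _
  rw [h2.fderiv]
  simp

/-- Pointwise estimate for solutions of `Δf = curl F` in `ℝ²`:
`|f(x)| ≤ C r⁻¹‖f‖_{L²(B(x,r))} + C ∫_{B(x,r)} |F(y)|/|y−x| dy`. -/
theorem pointwise_bound_laplacian_eq_curl :
    ∃ C > 0, ∀ (f : EuclideanSpace ℝ (Fin 2) → ℝ)
      (F : EuclideanSpace ℝ (Fin 2) → EuclideanSpace ℝ (Fin 2)),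
      ContDiff ℝ (⊤ : ℕ∞) f → ContDiff ℝ (⊤ : ℕ∞) F →
      (∀ x, fderiv ℝ (fun y => fderiv ℝ f y (EuclideanSpace.single 0 1)) x
              (EuclideanSpace.single 0 1)
           + fderiv ℝ (fun y => fderiv ℝ f y (EuclideanSpace.single 1 1)) x
              (EuclideanSpace.single 1 1)
          = fderiv ℝ (fun y => F y 1) x (EuclideanSpace.single 0 1)
            - fderiv ℝ (fun y => F y 0) x (EuclideanSpace.single 1 1)) →
      ∀ (x : EuclideanSpace ℝ (Fin 2)) (r : ℝ), 0 < r →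
        |f x| ≤ C * r⁻¹ * Real.sqrt (∫ y in Metric.ball x r, (f y) ^ 2)
              + C * ∫ y in Metric.ball x r, ‖F y‖ / ‖y - x‖ := by
  obtain ⟨C, hC, H⟩ := exists_abs_apply_zero_le
  refine ⟨C, hC, fun f F hf hF heq x r hr => ?_⟩
  have sm : ∀ v : E2, ContDiff ℝ ∞ fun y => fderiv ℝ f y v := fun v =>
    (hf.fderiv_right (m := ∞) (by simp)).clm_apply contDiff_const
  have sF : ∀ j : Fin 2, ContDiff ℝ ∞ fun y => F y j := fun j => by fun_prop
  have dsm : ∀ v : E2, Differentiable ℝ fun y => fderiv ℝ f y v := fun v =>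
    (sm v).differentiable (by simp)
  have dF : ∀ j : Fin 2, Differentiable ℝ fun y => F y j := fun j =>
    (sF j).differentiable (by simp)
  have L : ∀ v y : E2, fderiv ℝ (fun y => fderiv ℝ (fun y => f (x + r • y)) y v) y v
      = r ^ 2 * fderiv ℝ (fun y => fderiv ℝ f y v) (x + r • y) v := by
    intro v y
    simp_rw [fderiv_comp_add_smul_apply (hf.differentiable (by simp)) x r]
    rw [fderiv_const_mul (by have := dsm v; fun_prop), _root_.smul_apply,
      fderiv_comp_add_smul_apply (dsm v), smul_eq_mul]
    ring
  have K : ∀ (j : Fin 2) (v y : E2), fderiv ℝ (fun y => (r • F (x + r • y)) j) y v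
      = r ^ 2 * fderiv ℝ (fun y => F y j) (x + r • y) v := by
    intro j v y
    have hd : DifferentiableAt ℝ (fun y => F (x + r • y) j) y :=
      (dF j).comp (by fun_prop : Differentiable ℝ fun y : E2 => x + r • y) y
    simp only [PiLp.smul_apply, smul_eq_mul]
    rw [fderiv_const_mul hd, _root_.smul_apply,
      fderiv_comp_add_smul_apply (dF j), smul_eq_mul]
    ring
  have key := H (fun y => f (x + r • y)) (fun y => r • F (x + r • y)) (by fun_prop) (by fun_prop)
    (fun y => by rw [L, L, K, K, ← mul_add, ← mul_sub, heq])
  have e1 := setIntegral_ball_comp_add_smul (fun z => f z ^ 2) x hr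
  have e2 := setIntegral_ball_comp_add_smul (fun z => r ^ 2 * (‖F z‖ / ‖z - x‖)) x hr
  have e3 : ∀ y : E2, r ^ 2 * (‖F (x + r • y)‖ / ‖x + r • y - x‖)
      = ‖r • F (x + r • y)‖ / ‖y‖ := by
    intro y
    rw [add_sub_cancel_left, norm_smul, norm_smul, Real.norm_of_nonneg hr.le]
    by_cases hy : ‖y‖ = 0
    · simp [hy]
    field_simp
  simp only [e3] at e2
  rw [integral_const_mul, inv_mul_cancel_left₀ (by positivity)] at e2
  rw [e1, e2, Real.sqrt_mul (by positivity), Real.sqrt_inv, Real.sqrt_sq hr.le, ← mul_assoc,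
    smul_zero, add_zero] at key
  exact key
end

section
/- Let ρ : ℝ² → [0, C₀] be measurable, let u̇ ∈ H¹(ℝ²)² and x ∈ ℝ², r > 0. Then ∫_{B(x,r)} |ρ(y)u̇(y)|/|y−x| dy ≤ C r C₀ ‖∇u̇‖_{L²(ℝ²)} + C C₀^{1/2} ‖√ρ u̇‖_{L²(ℝ²)}, with C an absolute constant. -/
open MeasureTheory

open Set Metric
open scoped ENNReal

/-- The Euclidean plane. -/
abbrev Plane := EuclideanSpace ℝ (Fin 2)

theorem enorm_sub_le_lintegral_fderiv {E F : Type*} [NormedAddCommGroup E] [NormedSpace ℝ E]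
    [MeasurableSpace E] [BorelSpace E] [SecondCountableTopology E]
    [NormedAddCommGroup F] [NormedSpace ℝ F] [CompleteSpace F] [SecondCountableTopology F]
    {v : E → F} (hv : Differentiable ℝ v) (y z : E) :
    ‖v y - v z‖ₑ ≤ ‖y - z‖ₑ * ∫⁻ t in Ioc (0 : ℝ) 1, ‖fderiv ℝ v (z + t • (y - z))‖ₑ := by
  have hline (t : ℝ) : HasDerivAt (fun t : ℝ => v (z + t • (y - z)))
      (fderiv ℝ v (z + t • (y - z)) (y - z)) t := by
    have h : HasDerivAt (fun t : ℝ => z + t • (y - z)) (y - z) t := by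
      simpa using ((hasDerivAt_id t).smul_const (y - z)).const_add z
    exact (hv _).hasFDerivAt.comp_hasDerivAt t h
  have hbound : ∫⁻ t in Ioc (0 : ℝ) 1, ‖fderiv ℝ v (z + t • (y - z)) (y - z)‖ₑ
      ≤ ‖y - z‖ₑ * ∫⁻ t in Ioc (0 : ℝ) 1, ‖fderiv ℝ v (z + t • (y - z))‖ₑ := by
    rw [← lintegral_const_mul' _ _ enorm_ne_top]
    refine lintegral_mono fun t => ?_
    rw [mul_comm]
    exact ContinuousLinearMap.le_opENorm _ _
  by_cases htop : ‖y - z‖ₑ * ∫⁻ t in Ioc (0 : ℝ) 1, ‖fderiv ℝ v (z + t • (y - z))‖ₑ = ∞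
  · simp [htop]
  have hmeas : StronglyMeasurable fun t : ℝ => fderiv ℝ v (z + t • (y - z)) (y - z) := by
    have : (fun t : ℝ => fderiv ℝ v (z + t • (y - z)) (y - z))
        = deriv fun t : ℝ => v (z + t • (y - z)) := funext fun t => (hline t).deriv.symm
    rw [this]
    exact stronglyMeasurable_deriv _
  have hint : IntervalIntegrable (fun t : ℝ => fderiv ℝ v (z + t • (y - z)) (y - z))
      volume 0 1 := by
    rw [intervalIntegrable_iff_integrableOn_Ioc_of_le zero_le_one]
    exact ⟨hmeas.aestronglyMeasurable, hbound.trans_lt (lt_top_iff_ne_top.2 htop)⟩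
  have hftc := intervalIntegral.integral_eq_sub_of_hasDerivAt (fun t _ => hline t) hint
  rw [intervalIntegral.integral_of_le zero_le_one] at hftc
  simp only [one_smul, add_sub_cancel, zero_smul, add_zero] at hftc
  rw [← hftc]
  exact (enorm_integral_le_lintegral_enorm _).trans hbound

theorem setLIntegral_le_sqrt_mul_sqrt {α : Type*} [MeasurableSpace α] {μ : Measure α} (s : Set α)
    {f : α → ℝ≥0∞} (hf : Measurable f) :
    ∫⁻ a in s, f a ∂μ ≤ μ s ^ (1 / 2 : ℝ) * (∫⁻ a in s, f a ^ 2 ∂μ) ^ (1 / 2 : ℝ) := by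
  have h := ENNReal.lintegral_mul_le_Lp_mul_Lq (μ.restrict s) Real.HolderConjugate.two_two
    (f := fun _ => 1) (g := f) aemeasurable_const hf.aemeasurable
  simpa using h

theorem lintegral_comp_add_smul {f : Plane → ℝ≥0∞} (hf : Measurable f) (a : Plane) {t : ℝ}
    (ht : t ≠ 0) :
    ∫⁻ y, f (a + t • y) = ENNReal.ofReal (t ^ 2)⁻¹ * ∫⁻ y, f y := by
  have h := lintegral_map (μ := (volume : Measure Plane)) (f := fun y => f (a + y))
    (g := fun y => t • y) (by fun_prop) (by fun_prop)
  rw [← h, Measure.map_addHaar_smul _ ht, lintegral_smul_measure, lintegral_add_left_eq_self]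
  simp

theorem setLIntegral_ball_comp_smul {f : Plane → ℝ≥0∞} (hf : Measurable f) {s : ℝ} (hs : 0 < s)
    (r : ℝ) :
    ∫⁻ y in ball 0 r, f (s • y) = ENNReal.ofReal (s ^ 2)⁻¹ * ∫⁻ y in ball 0 (s * r), f y := by
  rw [← lintegral_indicator measurableSet_ball, ← lintegral_indicator measurableSet_ball,
    ← lintegral_comp_add_smul (hf.indicator measurableSet_ball) 0 hs.ne']
  refine lintegral_congr fun y => ?_
  have : y ∈ ball (0 : Plane) r ↔ 0 + s • y ∈ ball (0 : Plane) (s * r) := by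
    simp [norm_smul, abs_of_pos hs, hs]
  by_cases hy : y ∈ ball (0 : Plane) r
  · rw [indicator_of_mem hy, indicator_of_mem (this.1 hy), zero_add]
  · rw [indicator_of_notMem hy, indicator_of_notMem (mt this.2 hy)]

theorem setLIntegral_ball_inv_enorm_lt_top :
    ∫⁻ y in ball (0 : Plane) 1, ‖y‖ₑ⁻¹ < ∞ := by
  have h : IntegrableOn (fun y : Plane => ‖y‖⁻¹) (ball 0 1) := by
    rw [integrableOn_fun_norm_addHaar volume (f := fun t : ℝ => t⁻¹)]
    refine IntegrableOn.congr_fun (f := fun _ => (1 : ℝ)) (by simp) (fun t ht => ?_)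
      measurableSet_Ioo
    simp [ht.1.ne']
  refine lt_of_eq_of_lt ?_ h.2
  refine lintegral_congr_ae (ae_restrict_of_ae ?_)
  filter_upwards [Measure.ae_ne volume (0 : Plane)] with y hy
  rw [enorm_inv (norm_ne_zero_iff.2 hy), enorm_norm]

theorem setLIntegral_ball_inv_enorm {s : ℝ} (hs : 0 < s) :
    ∫⁻ y in ball (0 : Plane) s, ‖y‖ₑ⁻¹
      = ENNReal.ofReal s * ∫⁻ y in ball (0 : Plane) 1, ‖y‖ₑ⁻¹ := by
  have h := setLIntegral_ball_comp_smul (f := fun y => ‖y‖ₑ⁻¹) (by fun_prop) hs 1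
  have h2 (y : Plane) : ‖s • y‖ₑ⁻¹ = ENNReal.ofReal s⁻¹ * ‖y‖ₑ⁻¹ := by
    rw [enorm_smul, ENNReal.mul_inv (by simp) (by simp), ENNReal.ofReal_inv_of_pos hs,
      Real.enorm_of_nonneg hs.le]
  simp only [h2, mul_one] at h
  rw [lintegral_const_mul' _ _ ENNReal.ofReal_ne_top] at h
  have h3 := congrArg (ENNReal.ofReal (s ^ 2) * ·) h
  simp only [← mul_assoc] at h3
  rw [← ENNReal.ofReal_mul (by positivity), ← ENNReal.ofReal_mul (by positivity)] at h3
  rw [mul_inv_cancel₀ (by positivity), ENNReal.ofReal_one, one_mul] at h3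
  rw [← h3]
  congr 2
  field_simp

/-- An averaged form of the Poincaré inequality on the unit disc. -/
theorem exists_setLIntegral_sq_enorm_sub_le {v : Plane → Plane} (hv : Differentiable ℝ v) :
    ∃ z, ∫⁻ y in ball (0 : Plane) 1, ‖v y - v z‖ₑ ^ 2 ≤ 16 * ∫⁻ y, ‖fderiv ℝ v y‖ₑ ^ 2 := by
  set G := ∫⁻ y, ‖fderiv ℝ v y‖ₑ ^ 2 with hG
  set B := ball (0 : Plane) 1 with hB
  have hvc : Continuous v := hv.continuous
  have hgm : Measurable fun y => ‖fderiv ℝ v y‖ₑ ^ 2 := (measurable_fderiv ℝ v).enorm.pow_const 2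
  have hgm1 : Measurable fun y => ‖fderiv ℝ v y‖ₑ := (measurable_fderiv ℝ v).enorm
  have hpt : ∀ z ∈ B, ∀ y ∈ B, ‖v y - v z‖ₑ ^ 2
      ≤ 4 * ∫⁻ t in Ioc (0 : ℝ) 1, ‖fderiv ℝ v (z + t • (y - z))‖ₑ ^ 2 := by
    intro z hz y hy
    have h1 : ‖y - z‖ₑ ≤ 2 := by
      have : ‖y - z‖ ≤ 2 := by
        have := norm_sub_le y z
        simp only [hB, mem_ball_zero_iff] at hy hz
        linarith
      rw [← ofReal_norm]
      exact (ENNReal.ofReal_le_ofReal this).trans (by simp)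
    have h2 := setLIntegral_le_sqrt_mul_sqrt (μ := volume) (Ioc (0 : ℝ) 1)
      (f := fun t => ‖fderiv ℝ v (z + t • (y - z))‖ₑ) (hgm1.comp (by fun_prop))
    simp only [Real.volume_Ioc, sub_zero, ENNReal.ofReal_one, ENNReal.one_rpow, one_mul] at h2
    calc ‖v y - v z‖ₑ ^ 2
        ≤ (2 * (∫⁻ t in Ioc (0 : ℝ) 1, ‖fderiv ℝ v (z + t • (y - z))‖ₑ ^ 2) ^ (1 / 2 : ℝ)) ^ 2 := by
          gcongr
          exact (enorm_sub_le_lintegral_fderiv hv y z).trans (by gcongr)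
      _ = _ := by
          rw [mul_pow, ← ENNReal.rpow_natCast (_ ^ (1 / 2 : ℝ)), ← ENNReal.rpow_mul]
          norm_num
  have hfib : ∀ t ∈ Ioc (0 : ℝ) 1, ∫⁻ z in B, ∫⁻ y in B, ‖fderiv ℝ v (z + t • (y - z))‖ₑ ^ 2
      ≤ 4 * volume B * G := by
    have hscale (a : Plane) {t : ℝ} (ht : 1 / 2 ≤ t) :
        ∫⁻ y in B, ‖fderiv ℝ v (a + t • y)‖ₑ ^ 2 ≤ 4 * G := by
      refine (setLIntegral_le_lintegral _ _).trans ?_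
      rw [lintegral_comp_add_smul hgm a (by positivity)]
      gcongr
      rw [show (4 : ℝ≥0∞) = ENNReal.ofReal 4 by simp]
      apply ENNReal.ofReal_le_ofReal
      rw [inv_le_comm₀ (by positivity) (by positivity)]
      nlinarith
    have hconst : ∫⁻ _ in B, 4 * G = 4 * volume B * G := by
      rw [setLIntegral_const]
      ring
    intro t ht
    rcases le_total (1 / 2) t with h | h
    · rw [← hconst]
      refine lintegral_mono fun z => ?_
      refine le_trans (le_of_eq ?_) (hscale ((1 - t) • z) h)
      congr! 5 with y
      module
    · rw [lintegral_lintegral_swap, ← hconst]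
      · refine lintegral_mono fun y => ?_
        refine le_trans (le_of_eq ?_) (hscale (t • y) (t := 1 - t) (by linarith))
        congr! 5 with z
        module
      · refine Measurable.aemeasurable ?_
        exact hgm.comp (by fun_prop)
  have hint : ∫⁻ z in B, ∫⁻ y in B, ‖v y - v z‖ₑ ^ 2 ≤ 16 * volume B * G := by
    calc ∫⁻ z in B, ∫⁻ y in B, ‖v y - v z‖ₑ ^ 2
        ≤ ∫⁻ z in B, ∫⁻ y in B,
            4 * ∫⁻ t in Ioc (0 : ℝ) 1, ‖fderiv ℝ v (z + t • (y - z))‖ₑ ^ 2 :=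
          setLIntegral_mono' measurableSet_ball fun z hz =>
            setLIntegral_mono' measurableSet_ball fun y hy => hpt z hz y hy
      _ = 4 * ∫⁻ z in B, ∫⁻ t in Ioc (0 : ℝ) 1, ∫⁻ y in B,
            ‖fderiv ℝ v (z + t • (y - z))‖ₑ ^ 2 := by
          rw [← lintegral_const_mul' _ _ (by simp)]
          refine lintegral_congr fun z => ?_
          rw [lintegral_const_mul' _ _ (by simp), lintegral_lintegral_swap]
          exact (hgm.comp (by fun_prop)).aemeasurable
      _ = 4 * ∫⁻ t in Ioc (0 : ℝ) 1, ∫⁻ z in B, ∫⁻ y in B,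
            ‖fderiv ℝ v (z + t • (y - z))‖ₑ ^ 2 := by
          rw [lintegral_lintegral_swap]
          refine Measurable.aemeasurable ?_
          exact Measurable.lintegral_prod_right' (f := fun p : (Plane × ℝ) × Plane =>
            ‖fderiv ℝ v (p.1.1 + p.1.2 • (p.2 - p.1.1))‖ₑ ^ 2) (hgm.comp (by fun_prop))
      _ ≤ 4 * ∫⁻ t in Ioc (0 : ℝ) 1, 4 * volume B * G := by
          gcongr 4 * ?_
          exact setLIntegral_mono' measurableSet_Ioc hfib
      _ = 16 * volume B * G := by
          rw [setLIntegral_const]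
          simp only [Real.volume_Ioc, sub_zero, ENNReal.ofReal_one]
          ring
  have hB0 : volume B ≠ 0 := (measure_ball_pos _ _ one_pos).ne'
  have hBt : volume B ≠ ∞ := measure_ball_lt_top.ne
  obtain ⟨z, -, hz⟩ := exists_le_setLAverage (μ := volume) (s := B)
    (f := fun z => ∫⁻ y in B, ‖v y - v z‖ₑ ^ 2) hB0 hBt
    (Measurable.aemeasurable (Measurable.lintegral_prod_right'
      (f := fun p : Plane × Plane => ‖v p.2 - v p.1‖ₑ ^ 2) (by fun_prop)))
  refine ⟨z, hz.trans ?_⟩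
  rw [setLAverage_eq]
  refine ENNReal.div_le_of_le_mul (hint.trans (le_of_eq ?_))
  ring

theorem setLIntegral_enorm_mul_inv_enorm_le {w : Plane → Plane} (hw : Differentiable ℝ w) :
    ∫⁻ y in ball (0 : Plane) 1, ‖w y‖ₑ * ‖y‖ₑ⁻¹
      ≤ 4 * (∫⁻ y in ball (0 : Plane) 1, ‖w y‖ₑ)
        + 2 * ∫⁻ y in ball (0 : Plane) 1, ‖fderiv ℝ w y‖ₑ := by
  have hwc : Continuous w := hw.continuous
  have hgm : Measurable fun y => ‖fderiv ℝ w y‖ₑ := (measurable_fderiv ℝ w).enorm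
  set A := ∫⁻ y in ball (0 : Plane) 1, ‖w y‖ₑ
  set H := ∫⁻ y in ball (0 : Plane) 1, ‖fderiv ℝ w y‖ₑ
  set I := ∫⁻ y in ball (0 : Plane) 1, ‖w y‖ₑ * ‖y‖ₑ⁻¹
  set I' := ∫⁻ y in ball (0 : Plane) (1 / 2), ‖w y‖ₑ * ‖y‖ₑ⁻¹
  set D := ∫⁻ y in ball (0 : Plane) 1, ‖w y - w ((1 / 2 : ℝ) • y)‖ₑ * ‖y‖ₑ⁻¹
  have hsub : ball (0 : Plane) (1 / 2) ⊆ ball 0 1 := ball_subset_ball (by norm_num)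
  have hI_top : I ≠ ∞ := by
    obtain ⟨M, hM⟩ := (isCompact_closedBall (0 : Plane) 1).exists_bound_of_continuousOn
      hwc.continuousOn
    refine ne_top_of_le_ne_top (b := ENNReal.ofReal M * ∫⁻ y in ball (0 : Plane) 1, ‖y‖ₑ⁻¹)
      (ENNReal.mul_ne_top ENNReal.ofReal_ne_top setLIntegral_ball_inv_enorm_lt_top.ne) ?_
    rw [← lintegral_const_mul' _ _ ENNReal.ofReal_ne_top]
    refine setLIntegral_mono' measurableSet_ball fun y hy => ?_
    gcongr
    rw [← ofReal_norm]
    exact ENNReal.ofReal_le_ofReal (hM y (ball_subset_closedBall hy))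
  have hI'_top : I' ≠ ∞ := ne_top_of_le_ne_top hI_top (lintegral_mono_set hsub)
  have hsplit : I ≤ I' + 2 * A := by
    have h1 : I = I' + ∫⁻ y in ball (0 : Plane) 1 \ ball 0 (1 / 2), ‖w y‖ₑ * ‖y‖ₑ⁻¹ := by
      have h := lintegral_inter_add_sdiff (μ := volume) (fun y : Plane => ‖w y‖ₑ * ‖y‖ₑ⁻¹)
        (ball (0 : Plane) 1) (measurableSet_ball (x := (0 : Plane)) (ε := 1 / 2))
      rw [inter_eq_self_of_subset_right hsub] at h
      exact h.symm
    rw [h1]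
    gcongr
    rw [← lintegral_const_mul' _ _ (by simp)]
    refine le_trans ?_ (lintegral_mono_set (sdiff_subset (t := ball 0 (1 / 2))))
    refine setLIntegral_mono' (measurableSet_ball.diff measurableSet_ball) fun y hy => ?_
    rw [mul_comm]
    gcongr
    rw [ENNReal.inv_le_iff_inv_le, ← ofReal_norm,
      show (2 : ℝ≥0∞)⁻¹ = ENNReal.ofReal (1 / 2) by
        rw [one_div, ENNReal.ofReal_inv_of_pos two_pos]; simp]
    exact ENNReal.ofReal_le_ofReal (by simpa using hy.2)
  have hscale : 4 * I' ≤ 2 * I + 2 * D := by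
    have h := setLIntegral_ball_comp_smul (f := fun y => ‖w y‖ₑ * ‖y‖ₑ⁻¹) (by fun_prop)
      (s := 1 / 2) (by norm_num) 1
    rw [mul_one, show ENNReal.ofReal ((1 / 2 : ℝ) ^ 2)⁻¹ = 4 by norm_num] at h
    rw [← h, ← mul_add, ← lintegral_add_left (by fun_prop), ← lintegral_const_mul' _ _ (by simp)]
    refine lintegral_mono fun y => ?_
    have h2 : ‖(1 / 2 : ℝ) • y‖ₑ⁻¹ = 2 * ‖y‖ₑ⁻¹ := by
      rw [enorm_smul, ENNReal.mul_inv (by simp) (by simp), Real.enorm_of_nonneg (by norm_num),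
        ← ENNReal.ofReal_inv_of_pos (by norm_num)]
      norm_num
    rw [h2, ← add_mul, ← mul_assoc, mul_comm _ 2, mul_assoc]
    gcongr
    have := enorm_sub_le (E := Plane) (a := w y) (b := w y - w ((1 / 2 : ℝ) • y))
    simpa using this
  have hD : D ≤ 2 * H := by
    have hpt (y : Plane) : ‖w y - w ((1 / 2 : ℝ) • y)‖ₑ * ‖y‖ₑ⁻¹
        ≤ 2⁻¹ * ∫⁻ t in Ioc (0 : ℝ) 1, ‖fderiv ℝ w (((1 + t) / 2) • y)‖ₑ := by
      have h1 := enorm_sub_le_lintegral_fderiv hw y ((1 / 2 : ℝ) • y)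
      have h2 : y - (1 / 2 : ℝ) • y = (1 / 2 : ℝ) • y := by module
      have h3 (t : ℝ) : (1 / 2 : ℝ) • y + t • (1 / 2 : ℝ) • y = ((1 + t) / 2) • y := by module
      have h4 : ‖(1 / 2 : ℝ)‖ₑ = 2⁻¹ := by
        rw [Real.enorm_of_nonneg (by norm_num), one_div, ENNReal.ofReal_inv_of_pos two_pos]
        simp
      simp only [h2, h3, enorm_smul, h4] at h1
      set T := ∫⁻ t in Ioc (0 : ℝ) 1, ‖fderiv ℝ w (((1 + t) / 2) • y)‖ₑ
      calc _ ≤ 2⁻¹ * ‖y‖ₑ * T * ‖y‖ₑ⁻¹ := by gcongr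
        _ = 2⁻¹ * T * (‖y‖ₑ * ‖y‖ₑ⁻¹) := by ring
        _ ≤ 2⁻¹ * T * 1 := by gcongr; exact ENNReal.mul_inv_le_one _
        _ = _ := mul_one _
    calc D ≤ ∫⁻ y in ball (0 : Plane) 1,
            2⁻¹ * ∫⁻ t in Ioc (0 : ℝ) 1, ‖fderiv ℝ w (((1 + t) / 2) • y)‖ₑ :=
          lintegral_mono hpt
      _ = 2⁻¹ * ∫⁻ t in Ioc (0 : ℝ) 1, ∫⁻ y in ball (0 : Plane) 1,
            ‖fderiv ℝ w (((1 + t) / 2) • y)‖ₑ := by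
          rw [lintegral_const_mul' _ _ (by simp), lintegral_lintegral_swap]
          exact (hgm.comp (by fun_prop)).aemeasurable
      _ ≤ 2⁻¹ * ∫⁻ t in Ioc (0 : ℝ) 1, 4 * H := by
          gcongr 2⁻¹ * ?_
          refine setLIntegral_mono' measurableSet_Ioc fun t ht => ?_
          have ht0 : 0 < t := ht.1
          have ht1 : t ≤ 1 := ht.2
          rw [setLIntegral_ball_comp_smul hgm (by linarith)]
          gcongr
          · rw [show (4 : ℝ≥0∞) = ENNReal.ofReal 4 by simp]
            apply ENNReal.ofReal_le_ofReal
            rw [inv_le_comm₀ (by positivity) (by positivity)]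
            nlinarith
          · exact lintegral_mono_set (ball_subset_ball (by linarith))
      _ = 2 * H := by
          rw [setLIntegral_const, ← mul_assoc, ← mul_assoc]
          simp only [Real.volume_Ioc, sub_zero, ENNReal.ofReal_one, mul_one]
          rw [show (4 : ℝ≥0∞) = 2 * 2 by norm_num, ← mul_assoc,
            ENNReal.inv_mul_cancel (by simp) (by simp), one_mul]
  have hI' : I' ≤ 2 * A + D := by
    have h1 : 2 * I' + 2 * I' ≤ 2 * I' + 2 * (2 * A + D) := by
      calc 2 * I' + 2 * I' = 4 * I' := by ring
        _ ≤ 2 * I + 2 * D := hscale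
        _ ≤ 2 * (I' + 2 * A) + 2 * D := by gcongr
        _ = _ := by ring
    have h2 := (ENNReal.add_le_add_iff_left (ENNReal.mul_ne_top (by simp) hI'_top)).1 h1
    exact (ENNReal.mul_le_mul_iff_right (by simp) (by simp)).1 h2
  calc I ≤ I' + 2 * A := hsplit
    _ ≤ (2 * A + 2 * H) + 2 * A := by gcongr; exact hI'.trans (by gcongr)
    _ = _ := by ring

/-- The bathtub estimate for the kernel `|y|⁻¹` against a bounded density. -/
theorem setLIntegral_mul_inv_enorm_le {ρ : Plane → ℝ≥0∞} (hρ : Measurable ρ) {c : ℝ≥0∞}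
    (hc0 : c ≠ 0) (hc : c ≠ ∞) (hρc : ∀ y, ρ y ≤ c) {s : Set Plane} (hs : volume s ≠ ∞) :
    ∫⁻ y in s, ρ y * ‖y‖ₑ⁻¹
      ≤ ((∫⁻ y in ball (0 : Plane) 1, ‖y‖ₑ⁻¹) + 1) * (c * ∫⁻ y in s, ρ y) ^ (1 / 2 : ℝ) := by
  set K := ∫⁻ y in ball (0 : Plane) 1, ‖y‖ₑ⁻¹ with hK
  have hKt : K ≠ ∞ := setLIntegral_ball_inv_enorm_lt_top.ne
  set m := ∫⁻ y in s, ρ y with hm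
  have hmt : m ≠ ∞ := by
    refine ne_top_of_le_ne_top (ENNReal.mul_ne_top hc hs) ?_
    rw [← setLIntegral_const]
    exact lintegral_mono hρc
  have hcut (t : ℝ) (ht : 0 < t) :
      ∫⁻ y in s, ρ y * ‖y‖ₑ⁻¹ ≤ c * (ENNReal.ofReal t * K) + (ENNReal.ofReal t)⁻¹ * m := by
    rw [← setLIntegral_ball_inv_enorm ht, ← lintegral_const_mul' _ _ hc,
      ← lintegral_const_mul _ hρ, ← lintegral_indicator measurableSet_ball]
    grw [← setLIntegral_le_lintegral s ((ball (0 : Plane) t).indicator _)]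
    rw [← lintegral_add_right _ (by fun_prop)]
    refine lintegral_mono fun y => ?_
    by_cases hy : y ∈ ball (0 : Plane) t
    · rw [indicator_of_mem hy]
      exact le_add_right (by gcongr; exact hρc y)
    · rw [indicator_of_notMem hy, zero_add, mul_comm]
      gcongr
      rw [← ofReal_norm]
      exact ENNReal.ofReal_le_ofReal (by simpa using hy)
  rcases eq_or_ne m 0 with h0 | h0
  · have hae : ρ =ᵐ[volume.restrict s] 0 := (lintegral_eq_zero_iff hρ).1 h0
    rw [lintegral_congr_ae (g := 0) (by filter_upwards [hae] with y hy; simp [hy])]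
    simp
  · have hq0 : m / c ≠ 0 := by simp [ENNReal.div_eq_zero_iff, h0, hc]
    have hqt : m / c ≠ ∞ := ENNReal.div_ne_top hmt hc0
    set q := (m / c) ^ (1 / 2 : ℝ) with hq
    have hq0' : q ≠ 0 := by simp [hq, ENNReal.rpow_eq_zero_iff, hq0, hqt]
    have hqt' : q ≠ ∞ := by simp [hq, ENNReal.rpow_eq_top_iff, hqt]
    have h := hcut q.toReal (ENNReal.toReal_pos hq0' hqt')
    rw [ENNReal.ofReal_toReal hqt'] at h
    have hcm : (c * m) ^ (1 / 2 : ℝ) = c * q := by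
      rw [show c * m = c ^ (2 : ℝ) * (m / c) by
        rw [ENNReal.rpow_two, sq, mul_assoc, ENNReal.mul_div_cancel hc0 hc],
        ENNReal.mul_rpow_of_nonneg _ _ (by norm_num), ← ENNReal.rpow_mul]
      norm_num [hq]
    have hqm : q⁻¹ * m = c * q := by
      have : c * q * q = m := by
        rw [mul_assoc, hq, ← ENNReal.rpow_add _ _ hq0 hqt]
        norm_num [ENNReal.mul_div_cancel hc0 hc]
      rw [← this, mul_comm, mul_assoc, ENNReal.mul_inv_cancel hq0' hqt', mul_one]
    rw [hcm]
    refine h.trans (le_of_eq ?_)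
    rw [hqm]
    ring

theorem exists_setLIntegral_ball_mul_inv_enorm_le :
    ∃ C : ℝ≥0∞, C ≠ ∞ ∧ ∀ (c : ℝ≥0∞) (ρ : Plane → ℝ≥0∞) (v : Plane → Plane),
      c ≠ 0 → c ≠ ∞ → Measurable ρ → (∀ y, ρ y ≤ c) → Differentiable ℝ v →
      ∫⁻ y in ball (0 : Plane) 1, ρ y * ‖v y‖ₑ * ‖y‖ₑ⁻¹
        ≤ C * (c * (∫⁻ y, ‖fderiv ℝ v y‖ₑ ^ 2) ^ (1 / 2 : ℝ)
          + (c * ∫⁻ y, ρ y * ‖v y‖ₑ ^ 2) ^ (1 / 2 : ℝ)) := by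
  set B := ball (0 : Plane) 1
  set K := ∫⁻ y in B, ‖y‖ₑ⁻¹
  have hKt : K ≠ ∞ := setLIntegral_ball_inv_enorm_lt_top.ne
  have hBt : volume B ≠ ∞ := measure_ball_lt_top.ne
  set b := volume B ^ (1 / 2 : ℝ)
  have hbt : b ≠ ∞ := ENNReal.rpow_ne_top_of_nonneg (by norm_num) hBt
  refine ⟨18 * b + (K + 1) * 32 ^ (1 / 2 : ℝ), by finiteness, ?_⟩
  intro c ρ v hc0 hc hρ hρc hv
  have hvc : Continuous v := hv.continuous
  obtain ⟨z, hz⟩ := exists_setLIntegral_sq_enorm_sub_le hv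
  set G := ∫⁻ y, ‖fderiv ℝ v y‖ₑ ^ 2
  set N := ∫⁻ y, ρ y * ‖v y‖ₑ ^ 2
  set m := ∫⁻ y in B, ρ y
  have h16 : (16 : ℝ≥0∞) ^ (1 / 2 : ℝ) = 4 := by
    rw [show (16 : ℝ≥0∞) = 4 ^ (2 : ℝ) by norm_num, ← ENNReal.rpow_mul]
    norm_num
  have hosc : ∫⁻ y in B, ‖v y - v z‖ₑ * ‖y‖ₑ⁻¹ ≤ 18 * b * G ^ (1 / 2 : ℝ) := by
    have h1 := setLIntegral_enorm_mul_inv_enorm_le (hv.sub_const (v z))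
    simp only [fderiv_sub_const] at h1
    have h2 : ∫⁻ y in B, ‖v y - v z‖ₑ ≤ b * (16 * G) ^ (1 / 2 : ℝ) :=
      (setLIntegral_le_sqrt_mul_sqrt B (by fun_prop)).trans (by gcongr)
    have h3 : ∫⁻ y in B, ‖fderiv ℝ v y‖ₑ ≤ b * G ^ (1 / 2 : ℝ) :=
      (setLIntegral_le_sqrt_mul_sqrt B (measurable_fderiv ℝ v).enorm).trans
        (by gcongr; exact setLIntegral_le_lintegral _ _)
    rw [ENNReal.mul_rpow_of_nonneg _ _ (by norm_num), h16] at h2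
    calc _ ≤ _ := h1
      _ ≤ 4 * (b * (4 * G ^ (1 / 2 : ℝ))) + 2 * (b * G ^ (1 / 2 : ℝ)) := by gcongr
      _ = _ := by ring
  have hmean : ‖v z‖ₑ ^ 2 * m ≤ 32 * (N + c * G) := by
    have hsq (y : Plane) : ‖v z‖ₑ ^ 2 ≤ 2 * (‖v y‖ₑ ^ 2 + ‖v y - v z‖ₑ ^ 2) := by
      have h1 : ‖v z‖ ^ 2 ≤ 2 * (‖v y‖ ^ 2 + ‖v y - v z‖ ^ 2) := by
        have := norm_sub_le (v y) (v y - v z)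
        rw [sub_sub_cancel] at this
        nlinarith [sq_nonneg (‖v y‖ - ‖v y - v z‖), norm_nonneg (v z)]
      have h2 := ENNReal.ofReal_le_ofReal h1
      rw [ENNReal.ofReal_mul (by norm_num),
        ENNReal.ofReal_add (by positivity) (by positivity)] at h2
      simpa [ENNReal.ofReal_pow] using h2
    calc ‖v z‖ₑ ^ 2 * m = ∫⁻ y in B, ‖v z‖ₑ ^ 2 * ρ y :=
          (lintegral_const_mul' _ _ (by finiteness)).symm
      _ ≤ ∫⁻ y in B, 2 * (ρ y * ‖v y‖ₑ ^ 2 + c * ‖v y - v z‖ₑ ^ 2) := by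
          refine lintegral_mono fun y => ?_
          calc ‖v z‖ₑ ^ 2 * ρ y ≤ 2 * (‖v y‖ₑ ^ 2 + ‖v y - v z‖ₑ ^ 2) * ρ y := by
                gcongr; exact hsq y
            _ = 2 * (ρ y * ‖v y‖ₑ ^ 2 + ρ y * ‖v y - v z‖ₑ ^ 2) := by ring
            _ ≤ _ := by gcongr; exact hρc y
      _ = 2 * (∫⁻ y in B, ρ y * ‖v y‖ₑ ^ 2) + 2 * (c * ∫⁻ y in B, ‖v y - v z‖ₑ ^ 2) := by
          rw [lintegral_const_mul' _ _ (by simp), lintegral_add_right _ (by fun_prop),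
            lintegral_const_mul' _ _ hc, mul_add]
      _ ≤ 2 * N + 2 * (c * (16 * G)) := by
          gcongr
          exact setLIntegral_le_lintegral _ _
      _ ≤ 32 * N + 2 * (c * (16 * G)) := by gcongr; norm_num
      _ = _ := by ring
  have hker : ‖v z‖ₑ * (∫⁻ y in B, ρ y * ‖y‖ₑ⁻¹)
      ≤ (K + 1) * 32 ^ (1 / 2 : ℝ) * ((c * N) ^ (1 / 2 : ℝ) + c * G ^ (1 / 2 : ℝ)) := by
    have hsqrt_sq (a : ℝ≥0∞) : (a ^ 2) ^ (1 / 2 : ℝ) = a := by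
      rw [← ENNReal.rpow_natCast, ← ENNReal.rpow_mul]
      norm_num
    calc _ ≤ ‖v z‖ₑ * ((K + 1) * (c * m) ^ (1 / 2 : ℝ)) := by
          gcongr
          exact setLIntegral_mul_inv_enorm_le hρ hc0 hc hρc hBt
      _ = (K + 1) * (c * (‖v z‖ₑ ^ 2 * m)) ^ (1 / 2 : ℝ) := by
          rw [mul_left_comm c, ENNReal.mul_rpow_of_nonneg (‖v z‖ₑ ^ 2) _ (by norm_num), hsqrt_sq]
          ring
      _ ≤ (K + 1) * (32 * (c * N + c ^ 2 * G)) ^ (1 / 2 : ℝ) := by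
          gcongr (K + 1) * ?_ ^ (1 / 2 : ℝ)
          calc c * (‖v z‖ₑ ^ 2 * m) ≤ c * (32 * (N + c * G)) := by gcongr
            _ = _ := by ring
      _ ≤ (K + 1) * (32 ^ (1 / 2 : ℝ) *
            ((c * N) ^ (1 / 2 : ℝ) + (c ^ 2 * G) ^ (1 / 2 : ℝ))) := by
          rw [ENNReal.mul_rpow_of_nonneg _ _ (by norm_num)]
          gcongr
          exact ENNReal.rpow_add_le_add_rpow _ _ (by norm_num) (by norm_num)
      _ = _ := by
          rw [ENNReal.mul_rpow_of_nonneg (c ^ 2) _ (by norm_num), hsqrt_sq]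
          ring
  calc ∫⁻ y in B, ρ y * ‖v y‖ₑ * ‖y‖ₑ⁻¹
      ≤ ∫⁻ y in B, (c * (‖v y - v z‖ₑ * ‖y‖ₑ⁻¹) + ‖v z‖ₑ * (ρ y * ‖y‖ₑ⁻¹)) := by
        refine lintegral_mono fun y => ?_
        have h1 : ‖v y‖ₑ ≤ ‖v y - v z‖ₑ + ‖v z‖ₑ := by
          simpa using enorm_add_le (v y - v z) (v z)
        calc ρ y * ‖v y‖ₑ * ‖y‖ₑ⁻¹ ≤ ρ y * (‖v y - v z‖ₑ + ‖v z‖ₑ) * ‖y‖ₑ⁻¹ := by gcongr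
          _ = ρ y * (‖v y - v z‖ₑ * ‖y‖ₑ⁻¹) + ‖v z‖ₑ * (ρ y * ‖y‖ₑ⁻¹) := by ring
          _ ≤ _ := by gcongr; exact hρc y
    _ = c * (∫⁻ y in B, ‖v y - v z‖ₑ * ‖y‖ₑ⁻¹) + ‖v z‖ₑ * ∫⁻ y in B, ρ y * ‖y‖ₑ⁻¹ := by
        rw [lintegral_add_left (by fun_prop), lintegral_const_mul' _ _ hc,
          lintegral_const_mul' _ _ enorm_ne_top]
    _ ≤ c * (18 * b * G ^ (1 / 2 : ℝ))
          + (K + 1) * 32 ^ (1 / 2 : ℝ) * ((c * N) ^ (1 / 2 : ℝ) + c * G ^ (1 / 2 : ℝ)) := by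
        gcongr
    _ ≤ c * (18 * b * G ^ (1 / 2 : ℝ))
          + (K + 1) * 32 ^ (1 / 2 : ℝ) * ((c * N) ^ (1 / 2 : ℝ) + c * G ^ (1 / 2 : ℝ))
          + 18 * b * (c * N) ^ (1 / 2 : ℝ) := le_self_add
    _ = _ := by ring

/-- Translation and dilation carry the estimate on the unit disc to an arbitrary disc. -/
theorem exists_setLIntegral_ball_mul_inv_enorm_sub_le :
    ∃ C : ℝ≥0∞, C ≠ ∞ ∧ ∀ (c : ℝ≥0∞) (ρ : Plane → ℝ≥0∞) (v : Plane → Plane),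
      c ≠ 0 → c ≠ ∞ → Measurable ρ → (∀ y, ρ y ≤ c) → Differentiable ℝ v →
      ∀ (x : Plane) (r : ℝ), 0 < r →
      ∫⁻ y in ball x r, ρ y * ‖v y‖ₑ * ‖y - x‖ₑ⁻¹
        ≤ C * (ENNReal.ofReal r * c * (∫⁻ y, ‖fderiv ℝ v y‖ₑ ^ 2) ^ (1 / 2 : ℝ)
          + (c * ∫⁻ y, ρ y * ‖v y‖ₑ ^ 2) ^ (1 / 2 : ℝ)) := by
  obtain ⟨C, hC, h⟩ := exists_setLIntegral_ball_mul_inv_enorm_le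
  refine ⟨C, hC, fun c ρ v hc0 hc hρ hρc hv x r hr => ?_⟩
  have hvc : Continuous v := hv.continuous
  set R := ENNReal.ofReal r with hR
  have hR0 : R ≠ 0 := by simp [hR, hr]
  have hRt : R ≠ ∞ := ENNReal.ofReal_ne_top
  have hR2 : ENNReal.ofReal (r ^ 2)⁻¹ = (R⁻¹) ^ 2 := by
    rw [ENNReal.ofReal_inv_of_pos (by positivity), ENNReal.ofReal_pow hr.le, ENNReal.inv_pow]
  have hfd (y : Plane) : ‖fderiv ℝ (fun y => v (x + r • y)) y‖ₑ ^ 2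
      = R ^ 2 * ‖fderiv ℝ v (x + r • y)‖ₑ ^ 2 := by
    have h1 : HasFDerivAt (fun y : Plane => x + r • y) (r • ContinuousLinearMap.id ℝ Plane) y :=
      ((hasFDerivAt_id y).const_smul r).const_add x
    have h2 := (hv (x + r • y)).hasFDerivAt.comp y h1
    rw [show (fun y => v (x + r • y)) = v ∘ fun y => x + r • y from rfl, h2.fderiv,
      ContinuousLinearMap.comp_smul, ContinuousLinearMap.comp_id, enorm_smul,
      Real.enorm_of_nonneg hr.le, mul_pow]
  have h1 := h c (fun y => ρ (x + r • y)) (fun y => v (x + r • y)) hc0 hc (by fun_prop)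
    (fun y => hρc _) (hv.comp (by fun_prop))
  simp only [hfd] at h1
  have hG := lintegral_comp_add_smul ((measurable_fderiv ℝ v).enorm.pow_const 2) x hr.ne'
  have hN := lintegral_comp_add_smul (f := fun y => ρ y * ‖v y‖ₑ ^ 2) (by fun_prop) x hr.ne'
  have hL := setLIntegral_ball_comp_smul
    (f := fun y => ρ (x + y) * ‖v (x + y)‖ₑ * ‖y‖ₑ⁻¹)
    (((hρ.comp (measurable_const_add x)).mul
      (hvc.measurable.comp (measurable_const_add x)).enorm).mul measurable_enorm.inv) hr 1
  have hsm (y : Plane) : ‖r • y‖ₑ⁻¹ = R⁻¹ * ‖y‖ₑ⁻¹ := by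
    rw [enorm_smul, ENNReal.mul_inv (by simp) (by simp), Real.enorm_of_nonneg hr.le]
  have htrans : ∫⁻ y in ball x r, ρ y * ‖v y‖ₑ * ‖y - x‖ₑ⁻¹
      = ∫⁻ y in ball (0 : Plane) (r * 1), ρ (x + y) * ‖v (x + y)‖ₑ * ‖y‖ₑ⁻¹ := by
    rw [← lintegral_indicator measurableSet_ball, ← lintegral_indicator measurableSet_ball,
      ← lintegral_add_left_eq_self _ x]
    refine lintegral_congr fun y => ?_
    simp [indicator]
  rw [← htrans, hR2] at hL
  rw [hR2] at hG hN
  rw [lintegral_const_mul' _ _ (by finiteness), hG, hN, ← mul_assoc, ← mul_pow,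
    ENNReal.mul_inv_cancel hR0 hRt, one_pow, one_mul] at h1
  set G := ∫⁻ y, ‖fderiv ℝ v y‖ₑ ^ 2
  set N := ∫⁻ y, ρ y * ‖v y‖ₑ ^ 2
  set L := ∫⁻ y in ball x r, ρ y * ‖v y‖ₑ * ‖y - x‖ₑ⁻¹
  set L' := ∫⁻ y in ball (0 : Plane) 1, ρ (x + r • y) * ‖v (x + r • y)‖ₑ * ‖y‖ₑ⁻¹ with hL'
  have hLL : L = R * L' := by
    have h2 : R⁻¹ * L' = R⁻¹ ^ 2 * L := by
      rw [← hL, hL', ← lintegral_const_mul' _ _ (by simp [hR0])]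
      refine lintegral_congr fun y => ?_
      rw [hsm]
      ring
    have h3 := congrArg (R ^ 2 * ·) h2
    simp only [← mul_assoc, ← mul_pow, ENNReal.mul_inv_cancel hR0 hRt, one_pow, one_mul] at h3
    rw [← h3, sq, mul_assoc R, ENNReal.mul_inv_cancel hR0 hRt, mul_one]
  have hsqrt : (c * (R⁻¹ ^ 2 * N)) ^ (1 / 2 : ℝ) = R⁻¹ * (c * N) ^ (1 / 2 : ℝ) := by
    rw [mul_left_comm, ENNReal.mul_rpow_of_nonneg _ _ (by norm_num), ← ENNReal.rpow_natCast,
      ← ENNReal.rpow_mul]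
    norm_num
  calc L = R * L' := hLL
    _ ≤ R * (C * (c * G ^ (1 / 2 : ℝ) + R⁻¹ * (c * N) ^ (1 / 2 : ℝ))) := by
        rw [← hsqrt]
        gcongr
    _ = C * (R * c * G ^ (1 / 2 : ℝ) + R * R⁻¹ * (c * N) ^ (1 / 2 : ℝ)) := by ring
    _ = _ := by rw [ENNReal.mul_inv_cancel hR0 hRt, one_mul]

theorem rpow_half_lintegral_eq_ofReal_sqrt {α : Type*} [MeasurableSpace α] {μ : Measure α}
    {f : α → ℝ} (hf : Integrable f μ) (hf0 : ∀ a, 0 ≤ f a) :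
    (∫⁻ a, ENNReal.ofReal (f a) ∂μ) ^ (1 / 2 : ℝ) = ENNReal.ofReal √(∫ a, f a ∂μ) := by
  rw [← ofReal_integral_eq_lintegral_ofReal hf (.of_forall hf0),
    ENNReal.ofReal_rpow_of_nonneg (integral_nonneg hf0) (by norm_num), Real.sqrt_eq_rpow]

/-- Kernel bound for `ρ u̇`: for `0 ≤ ρ ≤ C₀` and `u̇ ∈ H¹(ℝ²)`,
`∫_{B(x,r)} ρ|u̇|/|y−x| dy ≤ C r C₀ ‖∇u̇‖_{L²} + C C₀^{1/2} ‖√ρ u̇‖_{L²}`. -/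
theorem rho_udot_kernel_bound :
    ∃ C > 0, ∀ (C₀ : ℝ) (ρ : EuclideanSpace ℝ (Fin 2) → ℝ)
      (v : EuclideanSpace ℝ (Fin 2) → EuclideanSpace ℝ (Fin 2)),
      0 < C₀ → Measurable ρ → (∀ y, 0 ≤ ρ y) → (∀ y, ρ y ≤ C₀) →
      Differentiable ℝ v →
      Integrable (fun y => ρ y * ‖v y‖ ^ 2) →
      Integrable (fun y => ‖fderiv ℝ v y‖ ^ 2) →
      ∀ (x : EuclideanSpace ℝ (Fin 2)) (r : ℝ), 0 < r →
        (∫ y in Metric.ball x r, ρ y * ‖v y‖ / ‖y - x‖)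
          ≤ C * r * C₀ * Real.sqrt (∫ y, ‖fderiv ℝ v y‖ ^ 2)
            + C * Real.sqrt C₀ * Real.sqrt (∫ y, ρ y * ‖v y‖ ^ 2) := by
  obtain ⟨C, hC, h⟩ := exists_setLIntegral_ball_mul_inv_enorm_sub_le
  refine ⟨C.toReal + 1, by positivity, ?_⟩
  intro C₀ ρ v hC₀ hρ hρ0 hρC hv hN hG x r hr
  have hvc : Continuous v := hv.continuous
  have h1 := h (ENNReal.ofReal C₀) (fun y => ENNReal.ofReal (ρ y)) v (by simpa using hC₀)
    ENNReal.ofReal_ne_top hρ.ennreal_ofReal (fun y => ENNReal.ofReal_le_ofReal (hρC y)) hv x r hr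
  have hGe := rpow_half_lintegral_eq_ofReal_sqrt hG fun y => by positivity
  have hNe := rpow_half_lintegral_eq_ofReal_sqrt hN fun y => mul_nonneg (hρ0 y) (by positivity)
  simp only [ENNReal.ofReal_mul (hρ0 _), ENNReal.ofReal_pow (norm_nonneg _), ofReal_norm]
    at hGe hNe
  rw [ENNReal.mul_rpow_of_nonneg _ _ (by norm_num), hGe, hNe,
    ENNReal.ofReal_rpow_of_nonneg hC₀.le (by norm_num), ← Real.sqrt_eq_rpow,
    ← ENNReal.ofReal_mul hr.le, ← ENNReal.ofReal_mul (by positivity),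
    ← ENNReal.ofReal_mul (by positivity), ← ENNReal.ofReal_add (by positivity) (by positivity)] at h1
  rw [integral_eq_lintegral_of_nonneg_ae
    (.of_forall fun y => div_nonneg (mul_nonneg (hρ0 y) (norm_nonneg _)) (norm_nonneg _))
    (Measurable.aestronglyMeasurable (by fun_prop))]
  have h2 : ∫⁻ y in ball x r, ENNReal.ofReal (ρ y * ‖v y‖ / ‖y - x‖)
      ≤ ∫⁻ y in ball x r, ENNReal.ofReal (ρ y) * ‖v y‖ₑ * ‖y - x‖ₑ⁻¹ := by
    refine lintegral_mono fun y => ?_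
    rw [div_eq_mul_inv, ENNReal.ofReal_mul (mul_nonneg (hρ0 y) (norm_nonneg _)),
      ENNReal.ofReal_mul (hρ0 y), ofReal_norm, ← ofReal_norm (y - x)]
    gcongr
    exact ENNReal.ofReal_inv_le
  have h3 := ENNReal.toReal_mono (by finiteness) (h2.trans h1)
  rw [ENNReal.toReal_mul, ENNReal.toReal_ofReal (by positivity)] at h3
  refine h3.trans ?_
  calc _ ≤ (C.toReal + 1) * (r * C₀ * √(∫ y, ‖fderiv ℝ v y‖ ^ 2)
          + √C₀ * √(∫ y, ρ y * ‖v y‖ ^ 2)) := by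
        gcongr
        linarith
    _ = _ := by ring
end

section
/- For m ∈ [2,∞) and ℓ > 1 + m/2, there is C = C(m,ℓ) such that for all f ∈ H¹(ℝ²), (∫_{ℝ²} |f(x)|^m ⟨x⟩⁻² (log⟨x⟩)^{−ℓ} dx)^{1/m} ≤ C(‖f‖_{L²(B₁)} + ‖∇f‖_{L²(ℝ²)}), where ⟨x⟩ = e + √(1+|x|²) (any normalization making log⟨x⟩ ≥ 1). -/
open MeasureTheory

open scoped ENNReal

/-- Fundamental theorem of calculus inequality, with no integrability assumption. -/
theorem enorm_sub_le_setLIntegral_of_hasDerivAt {g g' : ℝ → ℝ} {a b c d : ℝ}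
    (hg : ∀ t ∈ Set.Icc c d, HasDerivAt g (g' t) t) (ha : a ∈ Set.Icc c d) (hb : b ∈ Set.Icc c d) :
    ‖g b - g a‖ₑ ≤ ∫⁻ t in Set.Icc c d, ‖g' t‖ₑ := by
  wlog hab : a ≤ b generalizing a b
  · rw [← enorm_neg, neg_sub]
    exact this hb ha (le_of_not_ge hab)
  by_cases htop : ∫⁻ t in Set.Icc c d, ‖g' t‖ₑ = ⊤
  · simp [htop]
  have hsub : Set.Icc a b ⊆ Set.Icc c d := Set.Icc_subset_Icc ha.1 hb.2
  have hmeas : AEStronglyMeasurable g' (volume.restrict (Set.Icc c d)) := by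
    refine (measurable_deriv g).aestronglyMeasurable.congr ?_
    filter_upwards [ae_restrict_mem measurableSet_Icc] with t ht using (hg t ht).deriv
  have hint : IntegrableOn g' (Set.Icc c d) := ⟨hmeas, lt_top_iff_ne_top.2 htop⟩
  have hii : IntervalIntegrable g' volume a b :=
    (intervalIntegrable_iff_integrableOn_Ioc_of_le hab).2
      (hint.mono_set (Set.Ioc_subset_Icc_self.trans hsub))
  have hftc := intervalIntegral.integral_eq_sub_of_hasDerivAt
    (fun t ht => hg t (hsub (by rwa [Set.uIcc_of_le hab] at ht))) hii
  rw [← hftc, intervalIntegral.integral_of_le hab]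
  exact (enorm_integral_le_lintegral_enorm _).trans
    (lintegral_mono_set (Set.Ioc_subset_Icc_self.trans hsub))

/-- The Cauchy–Schwarz inequality for lower Lebesgue integrals. -/
theorem sq_lintegral_mul_le {α : Type*} [MeasurableSpace α] {μ : Measure α} {f g : α → ℝ≥0∞}
    (hf : AEMeasurable f μ) (hg : AEMeasurable g μ) :
    (∫⁻ x, f x * g x ∂μ) ^ 2 ≤ (∫⁻ x, f x ^ 2 ∂μ) * ∫⁻ x, g x ^ 2 ∂μ := by
  have h := ENNReal.lintegral_mul_le_Lp_mul_Lq μ Real.HolderConjugate.two_two hf hg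
  calc (∫⁻ x, f x * g x ∂μ) ^ 2
      ≤ ((∫⁻ x, f x ^ (2 : ℝ) ∂μ) ^ (1 / (2 : ℝ)) * (∫⁻ x, g x ^ (2 : ℝ) ∂μ) ^ (1 / (2 : ℝ))) ^ 2 := by
        gcongr
        exact h
    _ = _ := by
        rw [mul_pow, ← ENNReal.rpow_mul_natCast, ← ENNReal.rpow_mul_natCast]
        norm_num

/-- One-dimensional Sobolev inequality on the unit interval for a power of a function. -/
theorem enorm_rpow_le_setLIntegral_unitInterval {g g' : ℝ → ℝ} {P : ℝ → ℝ≥0∞} {p x : ℝ} (hp : 1 < p)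
    (hg : ∀ t, HasDerivAt g (g' t) t) (hgP : ∀ t, ‖g' t‖ₑ ≤ P t)
    (hx : x ∈ Set.Icc (-1 / 2 : ℝ) (1 / 2)) :
    ‖g x‖ₑ ^ p ≤ ∫⁻ t in Set.Icc (-1 / 2 : ℝ) (1 / 2),
      ‖g t‖ₑ ^ (p - 1) * (‖g t‖ₑ + ENNReal.ofReal p * P t) := by
  have hgc : Continuous g := continuous_iff_continuousAt.2 fun t => (hg t).continuousAt
  have hgm : Measurable fun t => ‖g t‖ₑ := hgc.measurable.enorm
  set J := ∫⁻ t in Set.Icc (-1 / 2 : ℝ) (1 / 2), ‖g t‖ₑ ^ (p - 1) * (ENNReal.ofReal p * P t)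
  have habs : ∀ t, ‖|g t| ^ p‖ₑ = ‖g t‖ₑ ^ p := fun t => by
    rw [Real.enorm_rpow_of_nonneg (abs_nonneg _) (by linarith), Real.enorm_abs]
  have hpt : ∀ t ∈ Set.Icc (-1 / 2 : ℝ) (1 / 2), ‖g x‖ₑ ^ p ≤ ‖g t‖ₑ ^ p + J := by
    intro t ht
    have hd : ∀ s ∈ Set.Icc (-1 / 2 : ℝ) (1 / 2), HasDerivAt (fun s => |g s| ^ p)
        (p * |g s| ^ (p - 2) * g s * g' s) s := fun s _ =>
      (hasDerivAt_abs_rpow (g s) hp).comp s (hg s)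
    have hle := enorm_sub_le_setLIntegral_of_hasDerivAt hd ht hx
    have hJ : ∫⁻ s in Set.Icc (-1 / 2 : ℝ) (1 / 2), ‖p * |g s| ^ (p - 2) * g s * g' s‖ₑ ≤ J := by
      refine lintegral_mono fun s => ?_
      have h1 : ‖p * |g s| ^ (p - 2) * g s‖ₑ = ‖g s‖ₑ ^ (p - 1) * ENNReal.ofReal p := by
        rw [← Real.enorm_abs (g s), ← Real.enorm_rpow_of_nonneg (abs_nonneg _) (by linarith),
          ← Real.enorm_of_nonneg (by linarith : 0 ≤ p), ← enorm_mul,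
          ← Real.enorm_abs (p * _ * _), ← Real.enorm_abs (_ * p)]
        congr 1
        rw [abs_mul, abs_mul, abs_mul, abs_of_nonneg (Real.rpow_nonneg (abs_nonneg _) (p - 2)),
          abs_of_nonneg (Real.rpow_nonneg (abs_nonneg _) (p - 1))]
        rcases (abs_nonneg (g s)).eq_or_lt with h0 | h0
        · rw [← h0, Real.zero_rpow (by linarith : p - 1 ≠ 0)]
          simp
        · rw [show p - 1 = p - 2 + 1 by ring, Real.rpow_add_one h0.ne']
          ring
      rw [enorm_mul, h1, mul_assoc]
      gcongr
      exact hgP s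
    calc ‖g x‖ₑ ^ p = ‖|g t| ^ p + (|g x| ^ p - |g t| ^ p)‖ₑ := by rw [← habs x]; congr 1; ring
      _ ≤ ‖|g t| ^ p‖ₑ + ‖|g x| ^ p - |g t| ^ p‖ₑ := enorm_add_le _ _
      _ ≤ ‖g t‖ₑ ^ p + J := by rw [habs t]; gcongr; exact hle.trans hJ
  have hvol : volume (Set.Icc (-1 / 2 : ℝ) (1 / 2)) = 1 := by
    rw [Real.volume_Icc]; norm_num
  calc ‖g x‖ₑ ^ p = ∫⁻ _ in Set.Icc (-1 / 2 : ℝ) (1 / 2), ‖g x‖ₑ ^ p := by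
        rw [setLIntegral_const, hvol, mul_one]
    _ ≤ ∫⁻ t in Set.Icc (-1 / 2 : ℝ) (1 / 2), (‖g t‖ₑ ^ p + J) :=
        setLIntegral_mono' measurableSet_Icc hpt
    _ = (∫⁻ t in Set.Icc (-1 / 2 : ℝ) (1 / 2), ‖g t‖ₑ ^ p) + J := by
        rw [lintegral_add_right _ measurable_const, setLIntegral_const, hvol, mul_one]
    _ = _ := by
        rw [← lintegral_add_left (hgm.pow_const _)]
        refine lintegral_congr fun t => ?_
        rw [mul_add]
        congr 1
        conv_rhs => rw [← ENNReal.rpow_one ‖g t‖ₑ, ← ENNReal.rpow_mul, one_mul,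
          ← ENNReal.rpow_add_of_nonneg _ _ (by linarith) zero_le_one]
        simp

/-- Local Sobolev inequality on the unit square, in the critical dimension two. -/
theorem lintegral_unitSquare_rpow_le {u g₁ g₂ : ℝ × ℝ → ℝ} {P : ℝ × ℝ → ℝ≥0∞} {m : ℝ} (hm : 2 ≤ m)
    (hu : Continuous u) (hP : Measurable P)
    (h₁ : ∀ x y, HasDerivAt (fun s => u (s, y)) (g₁ (x, y)) x)
    (h₂ : ∀ x y, HasDerivAt (fun s => u (x, s)) (g₂ (x, y)) y)
    (hg₁ : ∀ z, ‖g₁ z‖ₑ ≤ P z) (hg₂ : ∀ z, ‖g₂ z‖ₑ ≤ P z) :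
    ∫⁻ z in Set.Icc (-1 / 2 : ℝ) (1 / 2) ×ˢ Set.Icc (-1 / 2 : ℝ) (1 / 2), ‖u z‖ₑ ^ m ≤
      (∫⁻ z in Set.Icc (-1 / 2 : ℝ) (1 / 2) ×ˢ Set.Icc (-1 / 2 : ℝ) (1 / 2),
        (‖u z‖ₑ + ENNReal.ofReal (m / 2) * P z) ^ 2) ^ (m / 2) := by
  have hvol : volume (Set.Icc (-1 / 2 : ℝ) (1 / 2)) = 1 := by
    rw [Real.volume_Icc]; norm_num
  set I := Set.Icc (-1 / 2 : ℝ) (1 / 2)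
  have hum : Measurable fun z => ‖u z‖ₑ := hu.measurable.enorm
  rcases hm.eq_or_lt with rfl | hm2
  · norm_num
    refine lintegral_mono fun z => ?_
    gcongr
    exact le_self_add
  set μ : Measure (ℝ × ℝ) := volume.restrict (I ×ˢ I) with hμ
  have hμprod : μ = (volume.restrict I).prod (volume.restrict I) := by
    rw [hμ, Measure.prod_restrict, Measure.volume_eq_prod]
  have hprob : IsProbabilityMeasure μ := ⟨by
    rw [hμ, Measure.restrict_apply_univ, Measure.volume_eq_prod, Measure.prod_prod, hvol, one_mul]⟩
  set Q : ℝ × ℝ → ℝ≥0∞ := fun z => ‖u z‖ₑ + ENNReal.ofReal (m / 2) * P z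
  have hQm : Measurable Q := hum.add (hP.const_mul _)
  set K : ℝ × ℝ → ℝ≥0∞ := fun z => ‖u z‖ₑ ^ (m / 2 - 1) * Q z
  have hKm : Measurable K := (hum.pow_const _).mul hQm
  set A := ∫⁻ z, ‖u z‖ₑ ^ m ∂μ
  set E := ∫⁻ z, Q z ^ 2 ∂μ
  have hAtop : A ≠ ⊤ := by
    have hc : Continuous fun z => |u z| ^ m :=
      hu.abs.rpow_const fun _ => Or.inr (by linarith)
    have := (hc.continuousOn.integrableOn_compact (μ := volume)
      (isCompact_Icc.prod isCompact_Icc : IsCompact (I ×ˢ I))).2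
    rw [HasFiniteIntegral] at this
    refine ne_of_lt (lt_of_eq_of_lt ?_ this)
    refine lintegral_congr fun z => ?_
    rw [Real.enorm_rpow_of_nonneg (abs_nonneg _) (by linarith), Real.enorm_abs]
  have hAK : A ≤ (∫⁻ z, K z ∂μ) ^ 2 := by
    have hα : Measurable fun y => ∫⁻ t in I, K (t, y) := hKm.lintegral_prod_left'
    have hβ : Measurable fun x => ∫⁻ t in I, K (x, t) := hKm.lintegral_prod_right'
    calc A ≤ ∫⁻ z, (∫⁻ t in I, K (z.1, t)) * (∫⁻ t in I, K (t, z.2)) ∂μ := by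
          refine setLIntegral_mono' (measurableSet_Icc.prod measurableSet_Icc) fun z hz => ?_
          have e1 := enorm_rpow_le_setLIntegral_unitInterval (p := m / 2) (by linarith)
            (fun t => h₁ t z.2) (fun t => hg₁ (t, z.2)) hz.1
          have e2 := enorm_rpow_le_setLIntegral_unitInterval (p := m / 2) (by linarith)
            (fun t => h₂ z.1 t) (fun t => hg₂ (z.1, t)) hz.2
          calc ‖u z‖ₑ ^ m = ‖u z‖ₑ ^ (m / 2) * ‖u z‖ₑ ^ (m / 2) := by
                rw [← ENNReal.rpow_add_of_nonneg _ _ (by linarith) (by linarith), add_halves]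
            _ ≤ _ := mul_le_mul' e2 e1
      _ = (∫⁻ z, K z ∂μ) ^ 2 := by
          rw [hμprod, lintegral_prod_mul hβ.aemeasurable hα.aemeasurable, sq,
            lintegral_prod _ hKm.aemeasurable]
          congr 1
          exact (lintegral_lintegral_swap hKm.aemeasurable).symm
  have hKE : (∫⁻ z, K z ∂μ) ^ 2 ≤ (∫⁻ z, ‖u z‖ₑ ^ (m - 2) ∂μ) * E := by
    refine (sq_lintegral_mul_le (hum.pow_const _).aemeasurable hQm.aemeasurable).trans_eq ?_
    congr 1
    refine lintegral_congr fun z => ?_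
    rw [← ENNReal.rpow_mul_natCast]
    congr 1
    push_cast
    ring
  have hmono : ∫⁻ z, ‖u z‖ₑ ^ (m - 2) ∂μ ≤ A ^ ((m - 2) / m) := by
    have h := eLpNorm_le_eLpNorm_of_exponent_le (μ := μ) (f := u)
      (p := ENNReal.ofReal (m - 2)) (q := ENNReal.ofReal m)
      (ENNReal.ofReal_le_ofReal (by linarith)) hu.aestronglyMeasurable
    rw [eLpNorm_eq_lintegral_rpow_enorm_toReal (by simpa using hm2) ENNReal.ofReal_ne_top,
      eLpNorm_eq_lintegral_rpow_enorm_toReal (by simp; linarith) ENNReal.ofReal_ne_top,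
      ENNReal.toReal_ofReal (by linarith), ENNReal.toReal_ofReal (by linarith)] at h
    have h' := ENNReal.rpow_le_rpow h (by linarith : 0 ≤ m - 2)
    rw [← ENNReal.rpow_mul, ← ENNReal.rpow_mul, one_div_mul_cancel (by linarith),
      ENNReal.rpow_one] at h'
    refine h'.trans_eq ?_
    congr 1
    ring
  have hfin : A ≤ A ^ ((m - 2) / m) * E :=
    hAK.trans (hKE.trans (mul_le_mul_left hmono _))
  rcases eq_or_ne A 0 with h0 | h0
  · rw [h0]; exact bot_le
  have hroot : A ^ (2 / m) ≤ E := by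
    have hpos : A ^ ((m - 2) / m) ≠ 0 := by simp [h0, hAtop]
    have htop : A ^ ((m - 2) / m) ≠ ⊤ := by simp [h0, hAtop]
    rw [← ENNReal.mul_le_mul_iff_right hpos htop]
    refine le_of_eq_of_le ?_ hfin
    rw [← ENNReal.rpow_add _ _ h0 hAtop]
    conv_rhs => rw [← ENNReal.rpow_one A]
    congr 1
    field_simp
    ring
  calc A = (A ^ (2 / m)) ^ (m / 2) := by
        rw [← ENNReal.rpow_mul]
        conv_lhs => rw [← ENNReal.rpow_one A]
        congr 1
        field_simp
    _ ≤ E ^ (m / 2) := ENNReal.rpow_le_rpow hroot (by linarith)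

theorem ENNReal.add_sq_le_two_mul {a b : ℝ≥0∞} : (a + b) ^ 2 ≤ 2 * (a ^ 2 + b ^ 2) := by
  have h := ENNReal.rpow_add_le_mul_rpow_add_rpow a b (one_le_two : (1 : ℝ) ≤ 2)
  norm_num at h
  exact h

/-- Local Sobolev inequality on balls of the plane. -/
theorem setLIntegral_ball_rpow_le {h : EuclideanSpace ℝ (Fin 2) → ℝ} (hh : Differentiable ℝ h)
    {m : ℝ} (hm : 2 ≤ m) :
    ∫⁻ y in Metric.ball 0 (1 / 2), ‖h y‖ₑ ^ m ≤
      (2 * (∫⁻ y in Metric.ball 0 1, ‖h y‖ₑ ^ 2) +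
        ENNReal.ofReal (m ^ 2 / 2) * ∫⁻ y, ‖fderiv ℝ h y‖ₑ ^ 2) ^ (m / 2) := by
  let e : ℝ × ℝ ≃ᵐ EuclideanSpace ℝ (Fin 2) :=
    MeasurableEquiv.finTwoArrow.symm.trans (MeasurableEquiv.toLp 2 (Fin 2 → ℝ))
  have he : MeasurePreserving e volume volume :=
    (PiLp.volume_preserving_toLp (Fin 2)).comp ((volume_preserving_finTwoArrow ℝ).symm _)
  have hecoe : ∀ z : ℝ × ℝ, e z =
      z.1 • EuclideanSpace.single 0 (1 : ℝ) + z.2 • EuclideanSpace.single 1 (1 : ℝ) := by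
    intro z
    ext i
    fin_cases i <;> simp [e, MeasurableEquiv.finTwoArrow]
  have henorm : ∀ z : ℝ × ℝ, ‖e z‖ ^ 2 = z.1 ^ 2 + z.2 ^ 2 := by
    intro z
    rw [EuclideanSpace.norm_sq_eq, Fin.sum_univ_two]
    simp [hecoe]
  have hec : Continuous e := by
    have : (e : ℝ × ℝ → EuclideanSpace ℝ (Fin 2)) = fun z => _ := funext hecoe
    rw [this]
    fun_prop
  have hfm : Measurable fun y => ‖fderiv ℝ h y‖ₑ := (measurable_fderiv ℝ h).enorm
  have hhm : Measurable fun y => ‖h y‖ₑ := hh.continuous.measurable.enorm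
  have hbound : ∀ (i : Fin 2) (z : ℝ × ℝ),
      ‖fderiv ℝ h (e z) (EuclideanSpace.single i (1 : ℝ))‖ₑ ≤ ‖fderiv ℝ h (e z)‖ₑ := by
    intro i z
    refine (ContinuousLinearMap.le_opENorm _ _).trans_eq ?_
    rw [← ofReal_norm (EuclideanSpace.single i (1 : ℝ)), PiLp.norm_single]
    simp
  have hsq := lintegral_unitSquare_rpow_le (u := fun z => h (e z)) (P := fun z => ‖fderiv ℝ h (e z)‖ₑ)
    hm (hh.continuous.comp hec) (hfm.comp e.measurable)
    (g₁ := fun z => fderiv ℝ h (e z) (EuclideanSpace.single 0 1))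
    (g₂ := fun z => fderiv ℝ h (e z) (EuclideanSpace.single 1 1))
    (fun x y => by
      refine (hh (e (x, y))).hasFDerivAt.comp_hasDerivAt x ?_
      simp only [hecoe]
      simpa using ((hasDerivAt_id x).smul_const (EuclideanSpace.single (0 : Fin 2) (1 : ℝ))).add_const
        (y • EuclideanSpace.single (1 : Fin 2) (1 : ℝ)))
    (fun x y => by
      refine (hh (e (x, y))).hasFDerivAt.comp_hasDerivAt y ?_
      simp only [hecoe]
      simpa using ((hasDerivAt_id y).smul_const (EuclideanSpace.single (1 : Fin 2) (1 : ℝ))).const_add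
        (x • EuclideanSpace.single (0 : Fin 2) (1 : ℝ)))
    (hbound 0) (hbound 1)
  have hsub₁ : e ⁻¹' Metric.ball 0 (1 / 2) ⊆
      Set.Icc (-1 / 2 : ℝ) (1 / 2) ×ˢ Set.Icc (-1 / 2 : ℝ) (1 / 2) := by
    intro z hz
    have hz' : ‖e z‖ < 1 / 2 := by simpa using hz
    have := henorm z
    have := norm_nonneg (e z)
    refine ⟨⟨?_, ?_⟩, ?_, ?_⟩ <;> nlinarith [sq_nonneg z.1, sq_nonneg z.2]
  have hsub₂ : Set.Icc (-1 / 2 : ℝ) (1 / 2) ×ˢ Set.Icc (-1 / 2 : ℝ) (1 / 2) ⊆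
      e ⁻¹' Metric.ball 0 1 := by
    rintro z ⟨⟨h1, h2⟩, h3, h4⟩
    have := henorm z
    have := norm_nonneg (e z)
    simp only [Set.mem_preimage, mem_ball_zero_iff]
    nlinarith
  rw [← he.setLIntegral_comp_preimage_emb e.measurableEmbedding]
  refine (lintegral_mono_set hsub₁).trans (hsq.trans ?_)
  refine ENNReal.rpow_le_rpow ?_ (by linarith)
  refine (lintegral_mono_set hsub₂).trans ?_
  rw [he.setLIntegral_comp_preimage_emb e.measurableEmbedding
    (fun y => (‖h y‖ₑ + ENNReal.ofReal (m / 2) * ‖fderiv ℝ h y‖ₑ) ^ 2)]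
  calc ∫⁻ y in Metric.ball 0 1, (‖h y‖ₑ + ENNReal.ofReal (m / 2) * ‖fderiv ℝ h y‖ₑ) ^ 2
      ≤ ∫⁻ y in Metric.ball 0 1,
          (2 * ‖h y‖ₑ ^ 2 + ENNReal.ofReal (m ^ 2 / 2) * ‖fderiv ℝ h y‖ₑ ^ 2) := by
        refine lintegral_mono fun y => ENNReal.add_sq_le_two_mul.trans_eq ?_
        have h2 : 2 * ENNReal.ofReal ((m / 2) ^ 2) = ENNReal.ofReal (m ^ 2 / 2) := by
          rw [← ENNReal.ofReal_ofNat 2, ← ENNReal.ofReal_mul zero_le_two]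
          congr 1
          ring
        rw [mul_add, mul_pow, ← mul_assoc, ← ENNReal.ofReal_pow (by linarith), h2]
    _ = 2 * (∫⁻ y in Metric.ball 0 1, ‖h y‖ₑ ^ 2) +
        ENNReal.ofReal (m ^ 2 / 2) * ∫⁻ y in Metric.ball 0 1, ‖fderiv ℝ h y‖ₑ ^ 2 := by
        rw [lintegral_add_left ((hhm.pow_const _).const_mul _), lintegral_const_mul _ (hhm.pow_const _),
          lintegral_const_mul _ (hfm.pow_const _)]
    _ ≤ _ := by
        gcongr
        exact Measure.restrict_le_self

theorem lintegral_comp_smul_plane (g : EuclideanSpace ℝ (Fin 2) → ℝ≥0∞) {r : ℝ} (hr : 0 < r) :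
    ∫⁻ y, g (r • y) = ENNReal.ofReal (r ^ 2)⁻¹ * ∫⁻ z, g z := by
  have h := lintegral_map_equiv (μ := volume) g
    (Homeomorph.smulOfNeZero (α := EuclideanSpace ℝ (Fin 2)) r hr.ne').toMeasurableEquiv
  have hmap := Measure.map_addHaar_smul (volume : Measure (EuclideanSpace ℝ (Fin 2))) hr.ne'
  rw [finrank_euclideanSpace_fin, abs_of_pos (by positivity)] at hmap
  change ∫⁻ z, g z ∂(Measure.map (fun y => r • y) volume) = ∫⁻ y, g (r • y) at h
  rw [← h, hmap, lintegral_smul_measure, smul_eq_mul]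

theorem setLIntegral_ball_comp_smul_plane (g : EuclideanSpace ℝ (Fin 2) → ℝ≥0∞) {r : ℝ} (hr : 0 < r)
    (ρ : ℝ) :
    ∫⁻ y in Metric.ball 0 ρ, g (r • y) =
      ENNReal.ofReal (r ^ 2)⁻¹ * ∫⁻ z in Metric.ball 0 (r * ρ), g z := by
  rw [← lintegral_indicator measurableSet_ball, ← lintegral_indicator measurableSet_ball,
    ← lintegral_comp_smul_plane _ hr]
  refine lintegral_congr fun y => ?_
  simp only [Set.indicator, mem_ball_zero_iff, norm_smul, Real.norm_of_nonneg hr.le]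
  simp only [mul_lt_mul_iff_right₀ hr]

/-- Conformal invariance of the Dirichlet integral in the plane under dilations. -/
theorem lintegral_fderiv_comp_smul_plane {f : EuclideanSpace ℝ (Fin 2) → ℝ} {r : ℝ} (hr : 0 < r) :
    ∫⁻ y, ‖fderiv ℝ (fun y => f (r • y)) y‖ₑ ^ 2 = ∫⁻ z, ‖fderiv ℝ f z‖ₑ ^ 2 := by
  have h : ∀ y, ‖fderiv ℝ (fun y => f (r • y)) y‖ₑ ^ 2 =
      ENNReal.ofReal (r ^ 2) * ‖fderiv ℝ f (r • y)‖ₑ ^ 2 := fun y => by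
    rw [fderiv_comp_smul, enorm_smul, mul_pow, Real.enorm_of_nonneg hr.le,
      ENNReal.ofReal_pow hr.le]
  have hm : Measurable fun y => ‖fderiv ℝ f (r • y)‖ₑ ^ 2 :=
    ((measurable_fderiv ℝ f).enorm.comp (measurable_const_smul r)).pow_const 2
  rw [lintegral_congr h, lintegral_const_mul _ hm,
    lintegral_comp_smul_plane (fun z => ‖fderiv ℝ f z‖ₑ ^ 2) hr, ← mul_assoc,
    ← ENNReal.ofReal_mul (by positivity), mul_inv_cancel₀ (by positivity), ENNReal.ofReal_one, one_mul]

theorem sq_mul_lintegral_Ioi_rpow_neg_three_le {a : ℝ} (ha : 0 < a) :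
    ENNReal.ofReal (a ^ 2) * ∫⁻ s in Set.Ioi a, ENNReal.ofReal (s ^ (-3 : ℝ)) ≤ 1 := by
  rw [← ofReal_integral_eq_lintegral_ofReal (integrableOn_Ioi_rpow_of_lt (by norm_num) ha)
    (by
      filter_upwards [ae_restrict_mem measurableSet_Ioi] with s hs
      exact Real.rpow_nonneg (ha.trans hs).le _),
    integral_Ioi_rpow_of_lt (by norm_num) ha, ← ENNReal.ofReal_mul (by positivity),
    ENNReal.ofReal_le_one]
  norm_num
  field_simp
  norm_num

/-- The radial energy of `f` along dilations of the unit ball, weighted so that it is bounded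
independently of the dilation range. -/
theorem lintegral_ball_lintegral_radial_le (f : EuclideanSpace ℝ (Fin 2) → ℝ) (r : ℝ) :
    ∫⁻ y in Metric.ball 0 1, ∫⁻ s in Set.Icc 1 r,
      ENNReal.ofReal s * (‖y‖ₑ ^ 2 * ‖fderiv ℝ f (s • y)‖ₑ ^ 2) ≤ ∫⁻ z, ‖fderiv ℝ f z‖ₑ ^ 2 := by
  have hfm : Measurable fun y => ‖fderiv ℝ f y‖ₑ := (measurable_fderiv ℝ f).enorm
  set G : EuclideanSpace ℝ (Fin 2) → ℝ≥0∞ := fun z => ‖z‖ₑ ^ 2 * ‖fderiv ℝ f z‖ₑ ^ 2 with hG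
  have hGm : Measurable G := (measurable_enorm.pow_const 2).mul (hfm.pow_const 2)
  set T : Set (ℝ × EuclideanSpace ℝ (Fin 2)) := {p | ‖p.2‖ < p.1} with hT
  have hTm : MeasurableSet T := measurableSet_lt measurable_snd.norm measurable_fst
  set k : ℝ → EuclideanSpace ℝ (Fin 2) → ℝ≥0∞ := fun s z =>
    T.indicator (fun p => ENNReal.ofReal (p.1 ^ (-3 : ℝ)) * G p.2) (s, z) with hk
  have hkm : Measurable (Function.uncurry k) := by
    have : Function.uncurry k = T.indicator (fun p => ENNReal.ofReal (p.1 ^ (-3 : ℝ)) * G p.2) := rfl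
    rw [this]
    exact ((measurable_fst.pow_const _).ennreal_ofReal.mul (hGm.comp measurable_snd)).indicator hTm
  have hm : Measurable (Function.uncurry fun (y : EuclideanSpace ℝ (Fin 2)) (s : ℝ) =>
      ENNReal.ofReal s * (‖y‖ₑ ^ 2 * ‖fderiv ℝ f (s • y)‖ₑ ^ 2)) :=
    measurable_snd.ennreal_ofReal.mul ((measurable_fst.enorm.pow_const 2).mul
      ((hfm.comp (measurable_snd.smul measurable_fst)).pow_const 2))
  rw [lintegral_lintegral_swap hm.aemeasurable]
  calc ∫⁻ s in Set.Icc 1 r, ∫⁻ y in Metric.ball 0 1,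
        ENNReal.ofReal s * (‖y‖ₑ ^ 2 * ‖fderiv ℝ f (s • y)‖ₑ ^ 2)
      = ∫⁻ s in Set.Icc 1 r, ∫⁻ z, k s z := by
        refine setLIntegral_congr_fun measurableSet_Icc fun s hs => ?_
        have hs0 : 0 < s := zero_lt_one.trans_le hs.1
        have h1 : ∀ y : EuclideanSpace ℝ (Fin 2),
            ENNReal.ofReal s * (‖y‖ₑ ^ 2 * ‖fderiv ℝ f (s • y)‖ₑ ^ 2) =
              ENNReal.ofReal s⁻¹ * G (s • y) := fun y => by
          simp only [hG]
          rw [enorm_smul, Real.enorm_of_nonneg hs0.le, mul_pow, ← ENNReal.ofReal_pow hs0.le,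
            ← mul_assoc, ← mul_assoc, ← mul_assoc, ← ENNReal.ofReal_mul (by positivity)]
          congr 3
          field_simp
        have h2 : ∀ z, k s z = (Metric.ball 0 s).indicator
            (fun z => ENNReal.ofReal (s ^ (-3 : ℝ)) * G z) z := fun z => by
          simp only [hk, hT, Set.indicator, Set.mem_ofPred_eq, mem_ball_zero_iff]
        rw [lintegral_congr h1, lintegral_congr h2, lintegral_indicator measurableSet_ball,
          lintegral_const_mul' _ _ ENNReal.ofReal_ne_top, lintegral_const_mul _ hGm,
          setLIntegral_ball_comp_smul_plane _ hs0, mul_one, ← mul_assoc,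
          ← ENNReal.ofReal_mul (by positivity)]
        congr 2
        rw [Real.rpow_neg hs0.le]
        norm_num
        field_simp
    _ = ∫⁻ z, ∫⁻ s in Set.Icc 1 r, k s z := lintegral_lintegral_swap hkm.aemeasurable
    _ ≤ _ := by
        refine lintegral_mono fun z => ?_
        rcases eq_or_ne z 0 with rfl | hz
        · simp [hk, hG, Set.indicator_apply]
        have h3 : ∀ s, k s z = G z * (Set.Ioi ‖z‖).indicator
            (fun s => ENNReal.ofReal (s ^ (-3 : ℝ))) s := fun s => by
          simp only [hk, hT, Set.indicator, Set.mem_ofPred_eq, Set.mem_Ioi]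
          split_ifs
          · exact mul_comm _ _
          · simp
        have hi : Measurable ((Set.Ioi ‖z‖).indicator
            (fun s : ℝ => ENNReal.ofReal (s ^ (-3 : ℝ)))) :=
          (measurable_id.pow_const _).ennreal_ofReal.indicator measurableSet_Ioi
        calc ∫⁻ s in Set.Icc 1 r, k s z ≤ ∫⁻ s, k s z := setLIntegral_le_lintegral _ _
          _ = ‖fderiv ℝ f z‖ₑ ^ 2 * (ENNReal.ofReal (‖z‖ ^ 2) *
                ∫⁻ s in Set.Ioi ‖z‖, ENNReal.ofReal (s ^ (-3 : ℝ))) := by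
              rw [lintegral_congr h3, lintegral_const_mul _ hi, lintegral_indicator measurableSet_Ioi,
                ENNReal.ofReal_pow (norm_nonneg _), ofReal_norm]
              simp only [hG]
              ring
          _ ≤ ‖fderiv ℝ f z‖ₑ ^ 2 * 1 := by
              gcongr
              exact sq_mul_lintegral_Ioi_rpow_neg_three_le (norm_pos_iff.2 hz)
          _ = _ := mul_one _

/-- Logarithmic growth of rescaled `L²` averages over balls of the plane. -/
theorem setLIntegral_ball_comp_smul_sq_le {f : EuclideanSpace ℝ (Fin 2) → ℝ}
    (hf : Differentiable ℝ f) {r : ℝ} (hr : 1 ≤ r) :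
    ∫⁻ y in Metric.ball 0 1, ‖f (r • y)‖ₑ ^ 2 ≤
      2 * (∫⁻ y in Metric.ball 0 1, ‖f y‖ₑ ^ 2) +
        2 * (ENNReal.ofReal (Real.log r) * ∫⁻ z, ‖fderiv ℝ f z‖ₑ ^ 2) := by
  have hfm : Measurable fun y => ‖fderiv ℝ f y‖ₑ := (measurable_fderiv ℝ f).enorm
  have hfc : Measurable fun y => ‖f y‖ₑ := hf.continuous.measurable.enorm
  have hlog : ∫⁻ s in Set.Icc 1 r, ENNReal.ofReal s⁻¹ = ENNReal.ofReal (Real.log r) := by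
    have hc : ContinuousOn (fun s : ℝ => s⁻¹) (Set.Icc 1 r) :=
      continuousOn_inv₀.mono fun s hs => (zero_lt_one.trans_le hs.1).ne'
    rw [← ofReal_integral_eq_lintegral_ofReal hc.integrableOn_Icc
      (by
        filter_upwards [ae_restrict_mem measurableSet_Icc] with s hs
        exact inv_nonneg.2 (zero_le_one.trans hs.1)),
      integral_Icc_eq_integral_Ioc, ← intervalIntegral.integral_of_le hr,
      integral_inv_of_pos one_pos (by linarith), div_one]
  have hpt : ∀ y, ‖f (r • y) - f y‖ₑ ^ 2 ≤ ENNReal.ofReal (Real.log r) *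
      ∫⁻ s in Set.Icc 1 r, ENNReal.ofReal s * (‖y‖ₑ ^ 2 * ‖fderiv ℝ f (s • y)‖ₑ ^ 2) := fun y => by
    have hd : ∀ s ∈ Set.Icc 1 r, HasDerivAt (fun s : ℝ => f (s • y)) (fderiv ℝ f (s • y) y) s :=
      fun s _ => (hf (s • y)).hasFDerivAt.comp_hasDerivAt s
        (by simpa using (hasDerivAt_id s).smul_const y)
    have h := enorm_sub_le_setLIntegral_of_hasDerivAt hd (Set.left_mem_Icc.2 hr)
      (Set.right_mem_Icc.2 hr)
    rw [one_smul] at h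
    have hm : Measurable fun s : ℝ => ‖fderiv ℝ f (s • y)‖ₑ :=
      hfm.comp (measurable_id.smul_const y)
    calc ‖f (r • y) - f y‖ₑ ^ 2
        ≤ (∫⁻ s in Set.Icc 1 r, ENNReal.ofReal (√s)⁻¹ *
            (ENNReal.ofReal (√s) * (‖y‖ₑ * ‖fderiv ℝ f (s • y)‖ₑ))) ^ 2 := by
          gcongr
          refine h.trans (setLIntegral_mono' measurableSet_Icc fun s hs => ?_)
          have hs0 : 0 < √s := Real.sqrt_pos.2 (zero_lt_one.trans_le hs.1)
          rw [← mul_assoc, ← ENNReal.ofReal_mul (by positivity), inv_mul_cancel₀ hs0.ne',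
            ENNReal.ofReal_one, one_mul, mul_comm]
          exact ContinuousLinearMap.le_opENorm _ _
      _ ≤ (∫⁻ s in Set.Icc 1 r, ENNReal.ofReal (√s)⁻¹ ^ 2) * ∫⁻ s in Set.Icc 1 r,
            (ENNReal.ofReal (√s) * (‖y‖ₑ * ‖fderiv ℝ f (s • y)‖ₑ)) ^ 2 :=
          sq_lintegral_mul_le (by fun_prop) (by fun_prop)
      _ = _ := by
          rw [← hlog]
          congr 1
          · refine setLIntegral_congr_fun measurableSet_Icc fun s hs => ?_
            rw [← ENNReal.ofReal_pow (by positivity), inv_pow,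
              Real.sq_sqrt (zero_le_one.trans hs.1)]
          · refine setLIntegral_congr_fun measurableSet_Icc fun s hs => ?_
            beta_reduce
            rw [mul_pow, mul_pow, ← ENNReal.ofReal_pow (by positivity),
              Real.sq_sqrt (zero_le_one.trans hs.1)]
  calc ∫⁻ y in Metric.ball 0 1, ‖f (r • y)‖ₑ ^ 2
      ≤ ∫⁻ y in Metric.ball 0 1, (2 * ‖f y‖ₑ ^ 2 + 2 * (ENNReal.ofReal (Real.log r) *
          ∫⁻ s in Set.Icc 1 r,
            ENNReal.ofReal s * (‖y‖ₑ ^ 2 * ‖fderiv ℝ f (s • y)‖ₑ ^ 2))) := by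
        refine lintegral_mono fun y => ?_
        calc ‖f (r • y)‖ₑ ^ 2 = ‖f y + (f (r • y) - f y)‖ₑ ^ 2 := by rw [add_sub_cancel]
          _ ≤ (‖f y‖ₑ + ‖f (r • y) - f y‖ₑ) ^ 2 := by gcongr; exact enorm_add_le _ _
          _ ≤ 2 * (‖f y‖ₑ ^ 2 + ‖f (r • y) - f y‖ₑ ^ 2) := ENNReal.add_sq_le_two_mul
          _ ≤ _ := by rw [mul_add]; gcongr; exact hpt y
    _ ≤ _ := by
        rw [lintegral_add_left ((hfc.pow_const 2).const_mul 2),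
          lintegral_const_mul _ (hfc.pow_const 2), lintegral_const_mul' _ _ (by simp),
          lintegral_const_mul' _ _ ENNReal.ofReal_ne_top]
        exact add_le_add le_rfl (mul_le_mul' le_rfl
          (mul_le_mul' le_rfl (lintegral_ball_lintegral_radial_le f r)))

theorem setLIntegral_ball_comp_two_pow_smul_rpow_le {f : EuclideanSpace ℝ (Fin 2) → ℝ}
    (hf : Differentiable ℝ f) {m : ℝ} (hm : 2 ≤ m) (k : ℕ) :
    ∫⁻ y in Metric.ball 0 (1 / 2), ‖f ((2 : ℝ) ^ k • y)‖ₑ ^ m ≤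
      (ENNReal.ofReal ((4 + m ^ 2) * (k + 1)) *
        ((∫⁻ y in Metric.ball 0 1, ‖f y‖ₑ ^ 2) + ∫⁻ z, ‖fderiv ℝ f z‖ₑ ^ 2)) ^ (m / 2) := by
  have h2k : (0 : ℝ) < 2 ^ k := by positivity
  refine (setLIntegral_ball_rpow_le (h := fun y => f ((2 : ℝ) ^ k • y))
    (hf.comp (by fun_prop : Differentiable ℝ fun y => (2 : ℝ) ^ k • y)) hm).trans ?_
  refine ENNReal.rpow_le_rpow ?_ (by linarith)
  rw [lintegral_fderiv_comp_smul_plane h2k]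
  set N := ∫⁻ y in Metric.ball 0 1, ‖f y‖ₑ ^ 2
  set D := ∫⁻ z, ‖fderiv ℝ f z‖ₑ ^ 2
  have hlog : Real.log ((2 : ℝ) ^ k) ≤ k := by
    rw [Real.log_pow]
    nlinarith [Real.log_two_lt_d9, (Nat.cast_nonneg k : (0 : ℝ) ≤ k)]
  have hk : (0 : ℝ) ≤ k := Nat.cast_nonneg k
  calc 2 * (∫⁻ y in Metric.ball 0 1, ‖f ((2 : ℝ) ^ k • y)‖ₑ ^ 2) + ENNReal.ofReal (m ^ 2 / 2) * D
      ≤ 2 * (2 * N + 2 * (ENNReal.ofReal k * D)) + ENNReal.ofReal (m ^ 2 / 2) * D := by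
        refine add_le_add (mul_le_mul' le_rfl
          ((setLIntegral_ball_comp_smul_sq_le hf (one_le_pow₀ one_le_two)).trans ?_)) le_rfl
        exact add_le_add le_rfl (mul_le_mul' le_rfl
          (mul_le_mul' (ENNReal.ofReal_le_ofReal hlog) le_rfl))
    _ = ENNReal.ofReal 4 * N + ENNReal.ofReal (4 * k + m ^ 2 / 2) * D := by
        rw [ENNReal.ofReal_add (by positivity) (by positivity), ENNReal.ofReal_mul (by norm_num),
          ENNReal.ofReal_ofNat]
        ring
    _ ≤ ENNReal.ofReal ((4 + m ^ 2) * (k + 1)) * N + ENNReal.ofReal ((4 + m ^ 2) * (k + 1)) * D :=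
        add_le_add (mul_le_mul' (ENNReal.ofReal_le_ofReal (by nlinarith [sq_nonneg m])) le_rfl)
          (mul_le_mul' (ENNReal.ofReal_le_ofReal (by nlinarith [sq_nonneg m])) le_rfl)
    _ = _ := (mul_add _ _ _).symm

/-- Bound of the logarithmic weight on the `k`-th dyadic annulus. -/
theorem rpow_neg_two_mul_log_rpow_le {J ℓ : ℝ} (hℓ : 0 ≤ ℓ) (k : ℕ) (hJ : Real.exp 1 ≤ J)
    (hkJ : 2 ^ k / 4 ≤ J) :
    J ^ (-(2 : ℝ)) * Real.log J ^ (-ℓ) ≤ 16 * ((k + 1 : ℝ) / 8) ^ (-ℓ) * ((2 ^ k : ℝ) ^ 2)⁻¹ := by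
  have hJ0 : 0 < J := (Real.exp_pos 1).trans_le hJ
  have h2k : (0 : ℝ) < 2 ^ k := by positivity
  have hlog1 : 1 ≤ Real.log J := (Real.le_log_iff_exp_le hJ0).2 hJ
  have hlogk : k * Real.log 2 - 2 * Real.log 2 ≤ Real.log J := by
    have h := Real.log_le_log (by positivity) hkJ
    rwa [Real.log_div h2k.ne' (by norm_num), Real.log_pow, show (4 : ℝ) = 2 ^ 2 by norm_num,
      Real.log_pow, Nat.cast_ofNat] at h
  have hlog : (k + 1 : ℝ) / 8 ≤ Real.log J := by
    nlinarith [Real.log_two_lt_d9, Real.log_two_gt_d9, (Nat.cast_nonneg k : (0 : ℝ) ≤ k)]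
  have h1 : J ^ (-(2 : ℝ)) ≤ 16 * ((2 ^ k : ℝ) ^ 2)⁻¹ := by
    refine (Real.rpow_le_rpow_of_nonpos (by positivity) hkJ (by norm_num)).trans_eq ?_
    rw [Real.rpow_neg (by positivity), Real.rpow_two, div_pow, inv_div]
    norm_num [div_eq_mul_inv]
  have h2 : Real.log J ^ (-ℓ) ≤ ((k + 1 : ℝ) / 8) ^ (-ℓ) :=
    Real.rpow_le_rpow_of_nonpos (by positivity) hlog (by linarith)
  calc J ^ (-(2 : ℝ)) * Real.log J ^ (-ℓ)
      ≤ 16 * ((2 ^ k : ℝ) ^ 2)⁻¹ * ((k + 1 : ℝ) / 8) ^ (-ℓ) :=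
        mul_le_mul h1 h2 (Real.rpow_nonneg (by linarith) _) (by positivity)
    _ = _ := by ring

theorem exists_dyadic_annulus {E : Type*} [SeminormedAddCommGroup E] (x : E) :
    ∃ k : ℕ, ‖x‖ < 2 ^ k * (1 / 2) ∧ (k = 0 ∨ 2 ^ k / 4 ≤ ‖x‖) := by
  classical
  have hex : ∃ k : ℕ, ‖x‖ < 2 ^ k * (1 / 2) := by
    obtain ⟨k, hk⟩ := pow_unbounded_of_one_lt (2 * ‖x‖) (one_lt_two : (1 : ℝ) < 2)
    exact ⟨k, by linarith⟩
  refine ⟨Nat.find hex, Nat.find_spec hex, ?_⟩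
  rcases hk : Nat.find hex with _ | j
  · exact Or.inl rfl
  · right
    have := Nat.find_min hex (m := j) (by omega)
    rw [pow_succ]
    linarith

/-- The weighted `L^m` estimate in terms of lower Lebesgue integrals. -/
theorem exists_lintegral_weighted_rpow_le {m ℓ : ℝ} (hm : 2 ≤ m) (hℓ : 1 + m / 2 < ℓ) :
    ∃ S : ℝ, 0 ≤ S ∧ ∀ f : EuclideanSpace ℝ (Fin 2) → ℝ, Differentiable ℝ f →
      ∫⁻ x, ‖f x‖ₑ ^ m * ENNReal.ofReal ((Real.exp 1 + √(1 + ‖x‖ ^ 2)) ^ (-(2 : ℝ)) *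
        Real.log (Real.exp 1 + √(1 + ‖x‖ ^ 2)) ^ (-ℓ)) ≤
      ENNReal.ofReal S *
        ((∫⁻ y in Metric.ball 0 1, ‖f y‖ₑ ^ 2) + ∫⁻ z, ‖fderiv ℝ f z‖ₑ ^ 2) ^ (m / 2) := by
  set a : ℕ → ℝ := fun k =>
    16 * ((k + 1 : ℝ) / 8) ^ (-ℓ) * ((4 + m ^ 2) * (k + 1 : ℝ)) ^ (m / 2) with ha
  have ha0 : ∀ k, 0 ≤ a k := fun k => by positivity
  have hsum : Summable a := by
    have h := ((Real.summable_one_div_nat_add_rpow 1 (ℓ - m / 2)).2 (by linarith)).mul_left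
      (16 * (1 / 8 : ℝ) ^ (-ℓ) * (4 + m ^ 2) ^ (m / 2))
    refine h.congr fun k => ?_
    have hk : (0 : ℝ) < k + 1 := by positivity
    simp only [ha]
    rw [abs_of_pos hk, div_eq_mul_one_div (k + 1 : ℝ) 8, Real.mul_rpow hk.le (by norm_num),
      Real.mul_rpow (by positivity) hk.le, one_div ((k + 1 : ℝ) ^ _), ← Real.rpow_neg hk.le,
      show -(ℓ - m / 2) = -ℓ + m / 2 by ring, Real.rpow_add hk]
    ring
  refine ⟨∑' k, a k, tsum_nonneg ha0, fun f hf => ?_⟩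
  set N := ∫⁻ y in Metric.ball 0 1, ‖f y‖ₑ ^ 2
  set D := ∫⁻ z, ‖fderiv ℝ f z‖ₑ ^ 2
  set W : EuclideanSpace ℝ (Fin 2) → ℝ := fun x => (Real.exp 1 + √(1 + ‖x‖ ^ 2)) ^ (-(2 : ℝ)) *
    Real.log (Real.exp 1 + √(1 + ‖x‖ ^ 2)) ^ (-ℓ)
  set R : ℕ → Set (EuclideanSpace ℝ (Fin 2)) := fun k =>
    {x | ‖x‖ < 2 ^ k * (1 / 2) ∧ (k = 0 ∨ 2 ^ k / 4 ≤ ‖x‖)}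
  have hRm : ∀ k, MeasurableSet (R k) := fun k =>
    (measurableSet_lt measurable_norm measurable_const).inter
      ((MeasurableSet.const _).union (measurableSet_le measurable_const measurable_norm))
  have hcover : ⋃ k, R k = Set.univ :=
    Set.eq_univ_of_forall fun x => Set.mem_iUnion.2 (exists_dyadic_annulus x)
  have hpiece : ∀ k, ∫⁻ x in R k, ‖f x‖ₑ ^ m * ENNReal.ofReal (W x) ≤
      ENNReal.ofReal (a k) * (N + D) ^ (m / 2) := fun k => by
    have h2k : (0 : ℝ) < 2 ^ k := by positivity
    have hWle : ∀ x ∈ R k,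
        W x ≤ 16 * ((k + 1 : ℝ) / 8) ^ (-ℓ) * ((2 ^ k : ℝ) ^ 2)⁻¹ := fun x hx => by
      have hs : ‖x‖ ≤ √(1 + ‖x‖ ^ 2) := Real.le_sqrt_of_sq_le (by linarith)
      refine rpow_neg_two_mul_log_rpow_le (by linarith) k (by linarith [norm_nonneg x]) ?_
      have he := Real.add_one_le_exp (1 : ℝ)
      rcases hx.2 with rfl | h
      · norm_num
        linarith [norm_nonneg x]
      · linarith
    calc ∫⁻ x in R k, ‖f x‖ₑ ^ m * ENNReal.ofReal (W x)
        ≤ ∫⁻ x in R k, ENNReal.ofReal (16 * ((k + 1 : ℝ) / 8) ^ (-ℓ)) *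
            (ENNReal.ofReal ((2 ^ k : ℝ) ^ 2)⁻¹ * ‖f x‖ₑ ^ m) := by
          refine setLIntegral_mono' (hRm k) fun x hx => ?_
          rw [← mul_assoc, ← ENNReal.ofReal_mul (by positivity), mul_comm]
          exact mul_le_mul' (ENNReal.ofReal_le_ofReal (hWle x hx)) le_rfl
      _ ≤ ENNReal.ofReal (16 * ((k + 1 : ℝ) / 8) ^ (-ℓ)) * (ENNReal.ofReal ((2 ^ k : ℝ) ^ 2)⁻¹ *
            ∫⁻ x in Metric.ball 0 (2 ^ k * (1 / 2)), ‖f x‖ₑ ^ m) := by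
          rw [lintegral_const_mul' _ _ ENNReal.ofReal_ne_top,
            lintegral_const_mul' _ _ ENNReal.ofReal_ne_top]
          refine mul_le_mul' le_rfl (mul_le_mul' le_rfl (lintegral_mono_set fun x hx => ?_))
          exact mem_ball_zero_iff.2 hx.1
      _ ≤ ENNReal.ofReal (16 * ((k + 1 : ℝ) / 8) ^ (-ℓ)) *
            (ENNReal.ofReal ((4 + m ^ 2) * (k + 1)) * (N + D)) ^ (m / 2) := by
          rw [← setLIntegral_ball_comp_smul_plane (fun x => ‖f x‖ₑ ^ m) h2k]
          exact mul_le_mul' le_rfl (setLIntegral_ball_comp_two_pow_smul_rpow_le hf hm k)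
      _ = _ := by
          rw [ENNReal.mul_rpow_of_nonneg _ _ (by linarith), ← mul_assoc,
            ENNReal.ofReal_rpow_of_nonneg (by positivity) (by linarith),
            ← ENNReal.ofReal_mul (by positivity)]
  calc ∫⁻ x, ‖f x‖ₑ ^ m * ENNReal.ofReal (W x)
      = ∫⁻ x in ⋃ k, R k, ‖f x‖ₑ ^ m * ENNReal.ofReal (W x) := by
        rw [hcover, Measure.restrict_univ]
    _ ≤ ∑' k, ∫⁻ x in R k, ‖f x‖ₑ ^ m * ENNReal.ofReal (W x) := lintegral_iUnion_le _ _
    _ ≤ ∑' k, ENNReal.ofReal (a k) * (N + D) ^ (m / 2) := ENNReal.tsum_le_tsum hpiece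
    _ = _ := by rw [ENNReal.tsum_mul_right, ENNReal.ofReal_tsum_of_nonneg ha0 hsum]

/-- Weighted `L^m` estimate: for `m ∈ [2,∞)` and `ℓ > 1 + m/2`,
`(∫ |f|^m ⟨x⟩⁻² (log⟨x⟩)^{−ℓ})^{1/m} ≤ C(‖f‖_{L²(B₁)} + ‖∇f‖_{L²(ℝ²)})`,
where `⟨x⟩ = e + √(1+|x|²)`. -/
theorem weighted_Lm_estimate (m ℓ : ℝ) (hm : 2 ≤ m) (hℓ : 1 + m / 2 < ℓ) :
    ∃ C > 0, ∀ f : EuclideanSpace ℝ (Fin 2) → ℝ,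
      Differentiable ℝ f →
      Integrable (fun x => (f x) ^ 2) →
      Integrable (fun x => ‖fderiv ℝ f x‖ ^ 2) →
      (∫ x, |f x| ^ m * (Real.exp 1 + Real.sqrt (1 + ‖x‖ ^ 2)) ^ (-(2:ℝ))
            * Real.log (Real.exp 1 + Real.sqrt (1 + ‖x‖ ^ 2)) ^ (-ℓ)) ^ (1 / m)
        ≤ C * (Real.sqrt (∫ x in Metric.ball (0 : EuclideanSpace ℝ (Fin 2)) 1, (f x) ^ 2)
            + Real.sqrt (∫ x, ‖fderiv ℝ f x‖ ^ 2)) := by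
  obtain ⟨S, hS, hbound⟩ := exists_lintegral_weighted_rpow_le hm hℓ
  have hm0 : 0 < m := by linarith
  refine ⟨S ^ (1 / m) + 1, by positivity, fun f hf hf2 hdf2 => ?_⟩
  have hN : ∫⁻ y in Metric.ball 0 1, ‖f y‖ₑ ^ 2 =
      ENNReal.ofReal (∫ x in Metric.ball (0 : EuclideanSpace ℝ (Fin 2)) 1, f x ^ 2) := by
    rw [ofReal_integral_eq_lintegral_ofReal hf2.integrableOn (ae_of_all _ fun x => sq_nonneg (f x))]
    refine lintegral_congr fun x => ?_
    rw [← sq_abs, ENNReal.ofReal_pow (abs_nonneg _), ← Real.enorm_eq_ofReal_abs]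
  have hD : ∫⁻ z, ‖fderiv ℝ f z‖ₑ ^ 2 = ENNReal.ofReal (∫ x, ‖fderiv ℝ f x‖ ^ 2) := by
    rw [ofReal_integral_eq_lintegral_ofReal hdf2 (ae_of_all _ fun x => sq_nonneg _)]
    refine lintegral_congr fun x => ?_
    rw [ENNReal.ofReal_pow (norm_nonneg _), ofReal_norm]
  have hmain := hbound f hf
  rw [hN, hD] at hmain
  set n := ∫ x in Metric.ball (0 : EuclideanSpace ℝ (Fin 2)) 1, f x ^ 2
  set d := ∫ x, ‖fderiv ℝ f x‖ ^ 2
  have hn : 0 ≤ n := integral_nonneg fun x => sq_nonneg (f x)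
  have hd : 0 ≤ d := integral_nonneg fun x => sq_nonneg _
  have hlog : ∀ x : EuclideanSpace ℝ (Fin 2), 0 ≤ Real.log (Real.exp 1 + √(1 + ‖x‖ ^ 2)) :=
    fun x => Real.log_nonneg
      (by linarith [Real.add_one_le_exp (1 : ℝ), Real.sqrt_nonneg (1 + ‖x‖ ^ 2)])
  set X := ∫ x, |f x| ^ m * (Real.exp 1 + √(1 + ‖x‖ ^ 2)) ^ (-(2 : ℝ)) *
    Real.log (Real.exp 1 + √(1 + ‖x‖ ^ 2)) ^ (-ℓ)
  have hX0 : 0 ≤ X := integral_nonneg fun x =>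
    mul_nonneg (by positivity) (Real.rpow_nonneg (hlog x) _)
  have hXle : X ≤ S * (n + d) ^ (m / 2) := by
    rw [← ENNReal.ofReal_le_ofReal_iff (by positivity)]
    calc ENNReal.ofReal X = ‖X‖ₑ := (Real.enorm_of_nonneg hX0).symm
      _ ≤ _ := enorm_integral_le_lintegral_enorm _
      _ = _ := lintegral_congr fun x => by
          rw [mul_assoc, enorm_mul, Real.enorm_rpow_of_nonneg (abs_nonneg _) hm0.le, Real.enorm_abs,
            Real.enorm_of_nonneg (mul_nonneg (by positivity) (Real.rpow_nonneg (hlog x) _))]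
      _ ≤ _ := hmain
      _ = _ := by
          rw [← ENNReal.ofReal_add hn hd,
            ENNReal.ofReal_rpow_of_nonneg (by positivity) (by linarith), ← ENNReal.ofReal_mul hS]
  have hsqrt : √(n + d) ≤ √n + √d := by
    rw [Real.sqrt_le_left (by positivity)]
    nlinarith [Real.sq_sqrt hn, Real.sq_sqrt hd, Real.sqrt_nonneg n, Real.sqrt_nonneg d,
      mul_nonneg (Real.sqrt_nonneg n) (Real.sqrt_nonneg d)]
  calc X ^ (1 / m) ≤ (S * (n + d) ^ (m / 2)) ^ (1 / m) :=
        Real.rpow_le_rpow hX0 hXle (by positivity)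
    _ = S ^ (1 / m) * √(n + d) := by
        rw [Real.mul_rpow hS (by positivity), ← Real.rpow_mul (by positivity), Real.sqrt_eq_rpow]
        congr 2
        field_simp
    _ ≤ (S ^ (1 / m) + 1) * (√n + √d) := by
        gcongr
        linarith
end
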